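/- arXiv:math/0507318 — 5 statements merged into one kernel-verified Lean document; each statement's English description precedes it below -/
import Mathlib

section
/- Let n ≥ 2 and m ≥ 2 be integers and let 0 < r < ∞. Let f, g : [0, r] → ℝ be smooth with f(0) = g(0) = 0, f′(0) = g′(0) = 1, and f(t) > 0, g(t) > 0 for all t ∈ (0, r]. If (n−1)f′(t)/f(t) ≥ (m−1)g′(t)/g(t) for all t ∈ (0, r), then μ_n(f, r) ≥ μ_m(g, r). If instead (n−1)f′(t)/f(t) ≤ (m−1)g′(t)/g(t) for all t ∈ (0, r), then μ_n(f, r) ≤ μ_m(g, r). -/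
open scoped ENNReal Topology
open MeasureTheory

/-- `Sk κ` is the function `S_κ`: `sinh(√(-κ) t)/√(-κ)` for `κ < 0`, `t` for `κ = 0`,
and `sin(√κ t)/√κ` for `κ > 0`. -/
noncomputable def Sk (κ : ℝ) (t : ℝ) : ℝ :=
  if κ < 0 then Real.sinh (Real.sqrt (-κ) * t) / Real.sqrt (-κ)
  else if κ = 0 then t
  else Real.sin (Real.sqrt κ * t) / Real.sqrt κ

/-- The weighted fundamental tone `μ_n(w, ·)` on the interval `s ⊆ ℝ`: the infimum of
`∫_s φ'(t)² w(t)^(n-1) dt / ∫_s φ(t)² w(t)^(n-1) dt` over all smooth `φ : ℝ → ℝ`, not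
identically zero, with compact support contained in `s`.  Taking `s = Set.Ioo 0 r` gives
`μ_n(w, r)` and `s = Set.Ioi 0` gives `μ_n(w, ∞)`. -/
noncomputable def mu (n : ℕ) (w : ℝ → ℝ) (s : Set ℝ) : ℝ :=
  sInf { q : ℝ | ∃ φ : ℝ → ℝ, ContDiff ℝ (⊤ : ℕ∞) φ ∧ HasCompactSupport φ ∧ tsupport φ ⊆ s ∧
    φ ≠ 0 ∧
    q = (∫ t in s, deriv φ t ^ 2 * w t ^ (n - 1)) / ∫ t in s, φ t ^ 2 * w t ^ (n - 1) }

theorem exists_log_cutoff {r s ε : ℝ} (hs : 0 < s) (hsr : s < r) (hε : 0 < ε) :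
    ∃ η : ℝ → ℝ, ContDiff ℝ (⊤ : ℕ∞) η ∧ (∃ δ > 0, ∀ t ≤ δ, η t = 0) ∧ (∀ t, s ≤ t → η t = 1) ∧
      ∫ t in (0 : ℝ)..r, deriv η t ^ 2 * t ≤ ε := by
  obtain ⟨M, hM⟩ : ∃ M : ℝ, ∀ x ∈ Set.Icc (0 : ℝ) 1, ‖deriv Real.smoothTransition x‖ ≤ M := by
    refine isCompact_Icc.exists_bound_of_continuousOn (Continuous.continuousOn ?_)
    exact (Real.smoothTransition.contDiff (n := 1)).continuous_deriv le_rfl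
  set L : ℝ := 1 + |Real.log s| + M ^ 2 / ε with hL
  have hLpos : 0 < L := by positivity
  have hLs : -L < Real.log s := by
    have := neg_abs_le (Real.log s)
    have : 0 ≤ M ^ 2 / ε := by positivity
    linarith
  have hML : M ^ 2 / L ≤ ε := by
    rw [div_le_iff₀ hLpos]
    have : M ^ 2 = ε * (M ^ 2 / ε) := by field_simp
    have h2 : 0 ≤ |Real.log s| := abs_nonneg _
    nlinarith
  set δ : ℝ := Real.exp (-(2 * L)) with hδ
  set σ : ℝ := Real.exp (-L) with hσ
  have hδ0 : 0 < δ := Real.exp_pos _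
  have hδσ : δ < σ := Real.exp_lt_exp.2 (by linarith)
  have hσs : σ < s := by rw [← Real.exp_log hs]; exact Real.exp_lt_exp.2 hLs
  set p : ℝ → ℝ := fun t => (Real.log t + 2 * L) / L with hp
  set η : ℝ → ℝ := fun t => if t ≤ δ then 0 else Real.smoothTransition (p t) with hη
  have hη0 : ∀ t ≤ δ, η t = 0 := fun t ht => if_pos ht
  have hηpos : ∀ t, 0 < t → η t = Real.smoothTransition (p t) := by
    intro t ht
    by_cases h : t ≤ δ
    · rw [hη0 t h, Real.smoothTransition.zero_of_nonpos]
      refine div_nonpos_of_nonpos_of_nonneg ?_ hLpos.le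
      have := (Real.log_le_iff_le_exp ht).2 h
      linarith
    · exact if_neg h
  have hη1 : ∀ t, σ ≤ t → η t = 1 := by
    intro t ht
    have ht0 : 0 < t := (hδ0.trans hδσ).trans_le ht
    rw [hηpos t ht0, Real.smoothTransition.one_of_one_le]
    rw [hp, le_div_iff₀ hLpos]
    have := (Real.le_log_iff_exp_le ht0).2 ht
    linarith
  have hev : ∀ t, 0 < t → η =ᶠ[𝓝 t] fun u => Real.smoothTransition (p u) := fun t ht => by
    filter_upwards [lt_mem_nhds ht] with u hu using hηpos u hu
  have hsm : ContDiff ℝ (⊤ : ℕ∞) η := by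
    rw [contDiff_iff_contDiffAt]
    intro t
    rcases lt_or_ge t δ with h | h
    · refine (contDiffAt_const (c := (0 : ℝ))).congr_of_eventuallyEq ?_
      filter_upwards [gt_mem_nhds h] with u hu using hη0 u hu.le
    · have ht : 0 < t := hδ0.trans_le h
      refine ContDiffAt.congr_of_eventuallyEq ?_ (hev t ht)
      exact Real.smoothTransition.contDiffAt.comp t
        (((Real.contDiffAt_log.2 ht.ne').add contDiffAt_const).div_const L)
  have hderiv : ∀ t ∈ Set.Icc δ σ, ‖deriv η t‖ ≤ M * (t⁻¹ / L) := by
    intro t ht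
    have ht0 : 0 < t := hδ0.trans_le ht.1
    have hpd : HasDerivAt p (t⁻¹ / L) t :=
      ((Real.hasDerivAt_log ht0.ne').add_const _).div_const L
    have hSd : HasDerivAt Real.smoothTransition (deriv Real.smoothTransition (p t)) (p t) :=
      ((Real.smoothTransition.contDiff (n := 1)).differentiable one_ne_zero _).hasDerivAt
    have hcomp : HasDerivAt (fun u => Real.smoothTransition (p u)) _ t := hSd.comp t hpd
    rw [(hev t ht0).deriv_eq, hcomp.deriv, norm_mul,
      Real.norm_of_nonneg (by positivity : 0 ≤ t⁻¹ / L)]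
    have h1 := (Real.le_log_iff_exp_le ht0).2 ht.1
    have h2 := (Real.log_le_iff_le_exp ht0).2 ht.2
    refine mul_le_mul_of_nonneg_right (hM _ ⟨?_, ?_⟩) (by positivity)
    · exact div_nonneg (by linarith) hLpos.le
    · exact (div_le_one hLpos).2 (by linarith)
  have hcont : Continuous fun t => deriv η t ^ 2 * t :=
    ((hsm.continuous_deriv (by simp)).pow 2).mul continuous_id
  have hii : ∀ a b : ℝ, IntervalIntegrable (fun t => deriv η t ^ 2 * t) volume a b :=
    fun a b => hcont.intervalIntegrable a b
  have hI1 : ∫ t in (0 : ℝ)..δ, deriv η t ^ 2 * t = 0 := by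
    rw [intervalIntegral.integral_of_le hδ0.le, integral_Ioc_eq_integral_Ioo]
    refine setIntegral_eq_zero_of_forall_eq_zero fun t ht => ?_
    have : η =ᶠ[𝓝 t] fun _ => (0 : ℝ) := by
      filter_upwards [gt_mem_nhds ht.2] with u hu using hη0 u hu.le
    simp [this.deriv_eq]
  have hI3 : ∫ t in σ..r, deriv η t ^ 2 * t = 0 := by
    rw [intervalIntegral.integral_of_le (hσs.trans hsr).le]
    refine setIntegral_eq_zero_of_forall_eq_zero fun t ht => ?_
    have : η =ᶠ[𝓝 t] fun _ => (1 : ℝ) := by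
      filter_upwards [lt_mem_nhds ht.1] with u hu using hη1 u hu.le
    simp [this.deriv_eq]
  have hI2 : ∫ t in δ..σ, deriv η t ^ 2 * t ≤ M ^ 2 / L := by
    calc ∫ t in δ..σ, deriv η t ^ 2 * t ≤ ∫ t in δ..σ, M ^ 2 / L ^ 2 * t⁻¹ := by
          refine intervalIntegral.integral_mono_on hδσ.le (hii _ _) ?_ fun t ht => ?_
          · refine ContinuousOn.intervalIntegrable_of_Icc hδσ.le ?_
            exact continuousOn_const.mul
              (continuousOn_inv₀.mono fun t ht => (hδ0.trans_le ht.1).ne')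
          · have ht0 : 0 < t := hδ0.trans_le ht.1
            have h := pow_le_pow_left₀ (norm_nonneg _) (hderiv t ht) 2
            rw [Real.norm_eq_abs, sq_abs] at h
            calc _ ≤ (M * (t⁻¹ / L)) ^ 2 * t := mul_le_mul_of_nonneg_right h ht0.le
              _ = _ := by field_simp
      _ = M ^ 2 / L := by
          rw [intervalIntegral.integral_const_mul, integral_inv_of_pos hδ0 (hδ0.trans hδσ),
            hδ, hσ, ← Real.exp_sub, Real.log_exp]
          field_simp
          ring
  refine ⟨η, hsm, ⟨δ, hδ0, hη0⟩, fun t ht => hη1 t (hσs.le.trans ht), ?_⟩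
  rw [← intervalIntegral.integral_add_adjacent_intervals (hii 0 σ) (hii σ r),
    ← intervalIntegral.integral_add_adjacent_intervals (hii 0 δ) (hii δ σ), hI1, hI3]
  linarith

/-- Smooth functions with compact support contained in `s`. -/
structure IsTestFunction (s : Set ℝ) (φ : ℝ → ℝ) : Prop where
  contDiff : ContDiff ℝ (⊤ : ℕ∞) φ
  hasCompactSupport : HasCompactSupport φ
  tsupport_subset : tsupport φ ⊆ s

theorem IsTestFunction.continuous_deriv {s : Set ℝ} {φ : ℝ → ℝ} (h : IsTestFunction s φ) :
    Continuous (deriv φ) :=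
  h.contDiff.continuous_deriv (by simp)

theorem IsTestFunction.exists_tsupport_subset_Ioo {r : ℝ} (hr : 0 < r) {φ : ℝ → ℝ}
    (h : IsTestFunction (Set.Ioo 0 r) φ) :
    ∃ α β, 0 < α ∧ α < β ∧ β < r ∧ tsupport φ ⊆ Set.Ioo α β := by
  have hK : IsCompact (tsupport φ) := h.hasCompactSupport
  rcases (tsupport φ).eq_empty_or_nonempty with he | hne
  · exact ⟨r / 3, r / 2, by linarith, by linarith, by linarith, by simp [he]⟩
  · obtain ⟨u, hu, hu'⟩ := hK.exists_isLeast hne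
    obtain ⟨v, hv, hv'⟩ := hK.exists_isGreatest hne
    have hu0 := h.tsupport_subset hu
    have hv0 := h.tsupport_subset hv
    have huv : u ≤ v := hu' hv
    obtain ⟨h1, h2⟩ := hu0
    obtain ⟨h3, h4⟩ := hv0
    refine ⟨u / 2, (v + r) / 2, by linarith, by linarith, by linarith, fun t ht => ⟨?_, ?_⟩⟩
    · have : u ≤ t := hu' ht
      linarith
    · have : t ≤ v := hv' ht
      linarith

/-- Replacing a test function by a constant to the left of `s` (up to a small transition) and
cutting it off near the origin bounds the Dirichlet energy on the tail from below. -/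
theorem tail_rayleigh_le_of_lt {r C Λ s₀ s : ℝ} {b φ : ℝ → ℝ} (hs₀ : 0 < s₀) (hs₀s : s₀ < s)
    (hsr : s < r) (hbc : ContinuousOn b (Set.Icc 0 r)) (hb0 : ∀ t ∈ Set.Icc 0 r, 0 ≤ b t)
    (hbC : ∀ t ∈ Set.Icc 0 r, b t ≤ C * t) (hΛ0 : 0 ≤ Λ)
    (hΛ : ∀ ψ, IsTestFunction (Set.Ioo 0 r) ψ →
      Λ * ∫ t in (0 : ℝ)..r, ψ t ^ 2 * b t ≤ ∫ t in (0 : ℝ)..r, deriv ψ t ^ 2 * b t)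
    (hφ : IsTestFunction (Set.Ioo 0 r) φ) :
    Λ * ∫ t in s..r, φ t ^ 2 * b t ≤ ∫ t in s₀..r, deriv φ t ^ 2 * b t := by
  have hr : 0 < r := by linarith
  have hC : 0 ≤ C := by
    have h1 := hb0 r ⟨hr.le, le_rfl⟩
    have h2 := hbC r ⟨hr.le, le_rfl⟩
    exact nonneg_of_mul_nonneg_left (h1.trans h2) hr
  obtain ⟨α, β, hα, hαβ, hβr, hsupp⟩ := hφ.exists_tsupport_subset_Ioo hr
  set χ : ℝ → ℝ := fun t => Real.smoothTransition ((t - s₀) / (s - s₀)) with hχ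
  have hχs : ContDiff ℝ (⊤ : ℕ∞) χ :=
    Real.smoothTransition.contDiff.comp ((contDiff_id.sub contDiff_const).div_const _)
  have hχ0 : ∀ t ≤ s₀, χ t = 0 := fun t ht =>
    Real.smoothTransition.zero_of_nonpos
      (div_nonpos_of_nonpos_of_nonneg (by linarith) (by linarith))
  have hχ1 : ∀ t, s ≤ t → χ t = 1 := fun t ht =>
    Real.smoothTransition.one_of_one_le ((le_div_iff₀ (by linarith)).2 (by linarith))
  have hφ' : ContDiff ℝ (⊤ : ℕ∞) (deriv φ) := (contDiff_infty_iff_deriv.1 hφ.contDiff).2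
  have hχφ : ContDiff ℝ (⊤ : ℕ∞) fun t => χ t * deriv φ t := hχs.mul hφ'
  set P : ℝ → ℝ := fun t => ∫ u in s..t, χ u * deriv φ u with hP
  have hPd : ∀ t, HasDerivAt P (χ t * deriv φ t) t := fun t =>
    intervalIntegral.integral_hasDerivAt_right (hχφ.continuous.intervalIntegrable _ _)
      (hχφ.continuous.stronglyMeasurableAtFilter _ _) hχφ.continuous.continuousAt
  have hPs : ContDiff ℝ (⊤ : ℕ∞) P := by
    refine contDiff_infty_iff_deriv.2 ⟨fun t => (hPd t).differentiableAt, ?_⟩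
    rwa [funext fun t => (hPd t).deriv]
  have hP0 : ∀ t ≤ s₀, P t = P s₀ := by
    intro t ht
    have hadd := intervalIntegral.integral_add_adjacent_intervals
      (hχφ.continuous.intervalIntegrable (μ := volume) s s₀)
      (hχφ.continuous.intervalIntegrable s₀ t)
    have hz : ∫ u in s₀..t, χ u * deriv φ u = 0 := by
      rw [intervalIntegral.integral_symm, intervalIntegral.integral_of_le ht, neg_eq_zero]
      exact setIntegral_eq_zero_of_forall_eq_zero fun u hu => by rw [hχ0 u hu.2, zero_mul]
    rw [hz, add_zero] at hadd
    exact hadd.symm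
  have hP1 : ∀ t, s ≤ t → P t = φ t - φ s := by
    intro t ht
    have hcongr : P t = ∫ u in s..t, deriv φ u := by
      refine intervalIntegral.integral_congr fun u hu => ?_
      rw [Set.uIcc_of_le ht] at hu
      simp [hχ1 u hu.1]
    rw [hcongr]
    exact intervalIntegral.integral_deriv_eq_sub
      (fun u _ => (contDiff_infty_iff_deriv.1 hφ.contDiff).1 u)
      (hφ.continuous_deriv.intervalIntegrable _ _)
  set c : ℝ := φ s + P s₀ with hc
  refine le_of_forall_pos_le_add fun ε hε => ?_
  obtain ⟨η, hηs, ⟨δ, hδ, hη0⟩, hη1, hηI⟩ :=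
    exists_log_cutoff (r := r) (half_pos hs₀) (by linarith)
      (show 0 < ε / (c ^ 2 * C + 1) by positivity)
  set T : ℝ → ℝ := fun t => c * (η t - 1) + φ s + P t with hT
  have hT1 : ∀ t, s ≤ t → T t = φ t := by
    intro t ht
    simp only [hT]
    rw [hη1 t (by linarith), hP1 t ht]
    ring
  have hT0 : ∀ t ≤ min δ s₀, T t = 0 := by
    intro t ht
    simp only [hT]
    rw [hη0 t (ht.trans (min_le_left _ _)), hP0 t (ht.trans (min_le_right _ _)), hc]
    ring
  have hTz : ∀ t, t ∉ Set.Icc (min δ s₀) (max s β) → T t = 0 := by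
    intro t ht
    rw [Set.mem_Icc, not_and_or, not_le, not_le] at ht
    rcases ht with h | h
    · exact hT0 t h.le
    · rw [hT1 t ((le_max_left _ _).trans h.le)]
      exact image_eq_zero_of_notMem_tsupport fun hm =>
        ((le_max_right s β).trans_lt h).not_gt (hsupp hm).2
  have hTtest : IsTestFunction (Set.Ioo 0 r) T := by
    refine ⟨((contDiff_const.mul (hηs.sub contDiff_const)).add contDiff_const).add hPs,
      HasCompactSupport.intro isCompact_Icc hTz, ?_⟩
    have hsub : tsupport T ⊆ Set.Icc (min δ s₀) (max s β) :=
      closure_minimal (fun t ht => not_imp_comm.1 (hTz t) ht) isClosed_Icc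
    exact hsub.trans fun t ht =>
      ⟨(lt_min hδ hs₀).trans_le ht.1, ht.2.trans_lt (max_lt hsr hβr)⟩
  have hTd : ∀ t, deriv T t = c * deriv η t + χ t * deriv φ t := fun t =>
    ((((((contDiff_infty_iff_deriv.1 hηs).1 t).hasDerivAt.sub_const 1).const_mul c).add_const
      (φ s)).add (hPd t)).deriv
  have hη'0 : ∀ t, s₀ < t → deriv η t = 0 := by
    intro t ht
    have : η =ᶠ[𝓝 t] fun _ => (1 : ℝ) := by
      filter_upwards [lt_mem_nhds ht] with u hu using hη1 u (by linarith)
    simp [this.deriv_eq]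
  have hη'c : Continuous (deriv η) := hηs.continuous_deriv (by simp)
  have hii : ∀ (q : ℝ → ℝ), Continuous q → ∀ x y, 0 ≤ x → x ≤ y → y ≤ r →
      IntervalIntegrable (fun t => q t * b t) volume x y := fun q hq x y hx hxy hy =>
    ContinuousOn.intervalIntegrable_of_Icc hxy
      (hq.continuousOn.mul (hbc.mono (Set.Icc_subset_Icc hx hy)))
  have hT' := hTtest.continuous_deriv
  have hφ'c := hφ.continuous_deriv
  have hTc := hTtest.contDiff.continuous
  have hη2 := hη'c.pow 2
  have hleft : ∫ t in (0 : ℝ)..s₀, deriv T t ^ 2 * b t ≤ ε := by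
    calc ∫ t in (0 : ℝ)..s₀, deriv T t ^ 2 * b t
        ≤ ∫ t in (0 : ℝ)..s₀, c ^ 2 * C * (deriv η t ^ 2 * t) := by
          refine intervalIntegral.integral_mono_on hs₀.le
            (hii _ (hT'.pow 2) _ _ le_rfl hs₀.le (by linarith))
            ((by fun_prop : Continuous fun t => c ^ 2 * C * (deriv η t ^ 2 * t)).intervalIntegrable
              _ _) fun t ht => ?_
          rw [hTd, hχ0 t ht.2, zero_mul, add_zero]
          calc (c * deriv η t) ^ 2 * b t ≤ (c * deriv η t) ^ 2 * (C * t) :=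
                mul_le_mul_of_nonneg_left (hbC t ⟨ht.1, by linarith [ht.2]⟩) (sq_nonneg _)
            _ = _ := by ring
      _ ≤ c ^ 2 * C * ∫ t in (0 : ℝ)..r, deriv η t ^ 2 * t := by
          rw [intervalIntegral.integral_const_mul]
          refine mul_le_mul_of_nonneg_left ?_ (by positivity)
          refine intervalIntegral.integral_mono_interval le_rfl hs₀.le (by linarith) ?_
            ((by fun_prop : Continuous fun t => deriv η t ^ 2 * t).intervalIntegrable _ _)
          refine (ae_restrict_iff' measurableSet_Ioc).2 (Filter.Eventually.of_forall fun t ht => ?_)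
          exact mul_nonneg (sq_nonneg _) ht.1.le
      _ ≤ c ^ 2 * C * (ε / (c ^ 2 * C + 1)) := mul_le_mul_of_nonneg_left hηI (by positivity)
      _ ≤ ε := by
          rw [mul_div_assoc', div_le_iff₀ (by positivity)]
          nlinarith
  have hright : ∫ t in s₀..r, deriv T t ^ 2 * b t ≤ ∫ t in s₀..r, deriv φ t ^ 2 * b t := by
    refine intervalIntegral.integral_mono_on_of_le_Ioo (by linarith)
      (hii _ (hT'.pow 2) _ _ hs₀.le (by linarith) le_rfl)
      (hii _ (hφ'c.pow 2) _ _ hs₀.le (by linarith) le_rfl) fun t ht => ?_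
    refine mul_le_mul_of_nonneg_right ?_ (hb0 t ⟨hs₀.le.trans ht.1.le, ht.2.le⟩)
    rw [hTd, hη'0 t ht.1, mul_zero, zero_add, mul_pow]
    refine mul_le_of_le_one_left (sq_nonneg _) (pow_le_one₀ ?_ ?_)
    · exact Real.smoothTransition.nonneg _
    · exact Real.smoothTransition.le_one _
  have hmass : ∫ t in s..r, φ t ^ 2 * b t ≤ ∫ t in (0 : ℝ)..r, T t ^ 2 * b t := by
    have hcongr : ∫ t in s..r, φ t ^ 2 * b t = ∫ t in s..r, T t ^ 2 * b t := by
      refine intervalIntegral.integral_congr fun t ht => ?_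
      rw [Set.uIcc_of_le hsr.le] at ht
      simp only [hT1 t ht.1]
    rw [hcongr]
    refine intervalIntegral.integral_mono_interval (by linarith) hsr.le le_rfl ?_
      (hii _ (hTc.pow 2) _ _ le_rfl hr.le le_rfl)
    refine (ae_restrict_iff' measurableSet_Ioc).2 (Filter.Eventually.of_forall fun t ht => ?_)
    exact mul_nonneg (sq_nonneg _) (hb0 t ⟨ht.1.le, ht.2⟩)
  have hsplit := intervalIntegral.integral_add_adjacent_intervals
    (hii _ (hT'.pow 2) 0 s₀ le_rfl hs₀.le (by linarith))
    (hii _ (hT'.pow 2) s₀ r hs₀.le (by linarith) le_rfl)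
  have := hΛ T hTtest
  have := mul_le_mul_of_nonneg_left hmass hΛ0
  simp only [Pi.pow_apply] at hsplit
  linarith

theorem tail_rayleigh_le {r C Λ s : ℝ} {b φ : ℝ → ℝ} (hs : 0 < s)
    (hsr : s < r) (hbc : ContinuousOn b (Set.Icc 0 r)) (hb0 : ∀ t ∈ Set.Icc 0 r, 0 ≤ b t)
    (hbC : ∀ t ∈ Set.Icc 0 r, b t ≤ C * t) (hΛ0 : 0 ≤ Λ)
    (hΛ : ∀ ψ, IsTestFunction (Set.Ioo 0 r) ψ →
      Λ * ∫ t in (0 : ℝ)..r, ψ t ^ 2 * b t ≤ ∫ t in (0 : ℝ)..r, deriv ψ t ^ 2 * b t)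
    (hφ : IsTestFunction (Set.Ioo 0 r) φ) :
    Λ * ∫ t in s..r, φ t ^ 2 * b t ≤ ∫ t in s..r, deriv φ t ^ 2 * b t := by
  have hr : 0 < r := hs.trans hsr
  have hc : ContinuousOn (fun t => deriv φ t ^ 2 * b t) (Set.Icc 0 r) :=
    (hφ.continuous_deriv.pow 2).continuousOn.mul hbc
  have hd : ContinuousAt (fun x => ∫ t in x..r, deriv φ t ^ 2 * b t) s := by
    refine (intervalIntegral.integral_hasDerivAt_left
      ((hc.mono (Set.Icc_subset_Icc_left hs.le)).intervalIntegrable_of_Icc hsr.le)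
      ((hc.mono Set.Ioo_subset_Icc_self).stronglyMeasurableAtFilter isOpen_Ioo s ⟨hs, hsr⟩)
      (hc.continuousAt (Icc_mem_nhds hs hsr))).continuousAt
  refine ge_of_tendsto (hd.mono_left (nhdsWithin_le_nhds (s := Set.Iio s))) ?_
  filter_upwards [Ioo_mem_nhdsLT hs] with x hx
  exact tail_rayleigh_le_of_lt hx.1 hx.2 hsr hbc hb0 hbC hΛ0 hΛ hφ

/-- A Rayleigh quotient bound for the weight `b` transfers to a weight `a` whose logarithmic
derivative is at least that of `b`. -/
theorem rayleigh_le_of_logDeriv_le {r C Λ : ℝ} {a b A B φ : ℝ → ℝ} (hr : 0 < r)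
    (hac : ContinuousOn a (Set.Icc 0 r)) (hbc : ContinuousOn b (Set.Icc 0 r))
    (ha0 : ∀ t ∈ Set.Ioo 0 r, 0 < a t) (hbpos : ∀ t ∈ Set.Ioo 0 r, 0 < b t)
    (hb0 : ∀ t ∈ Set.Icc 0 r, 0 ≤ b t)
    (had : ∀ t ∈ Set.Ioo 0 r, HasDerivAt a (A t * a t) t)
    (hbd : ∀ t ∈ Set.Ioo 0 r, HasDerivAt b (B t * b t) t)
    (hBA : ∀ t ∈ Set.Ioo 0 r, B t ≤ A t)
    (hbC : ∀ t ∈ Set.Icc 0 r, b t ≤ C * t) (hΛ0 : 0 ≤ Λ)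
    (hΛ : ∀ ψ, IsTestFunction (Set.Ioo 0 r) ψ →
      Λ * ∫ t in (0 : ℝ)..r, ψ t ^ 2 * b t ≤ ∫ t in (0 : ℝ)..r, deriv ψ t ^ 2 * b t)
    (hφ : IsTestFunction (Set.Ioo 0 r) φ) :
    Λ * ∫ t in (0 : ℝ)..r, φ t ^ 2 * a t ≤ ∫ t in (0 : ℝ)..r, deriv φ t ^ 2 * a t := by
  obtain ⟨α, β, hα, hαβ, hβr, hsupp⟩ := hφ.exists_tsupport_subset_Ioo hr
  have hφc := hφ.contDiff.continuous
  have hφ'c := hφ.continuous_deriv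
  set q : ℝ → ℝ := fun t => deriv φ t ^ 2 - Λ * φ t ^ 2 with hq
  have hqc : Continuous q := by fun_prop
  have hq0 : ∀ t, t ∉ Set.Ioo α β → q t = 0 := by
    intro t ht
    have h1 : φ t = 0 := image_eq_zero_of_notMem_tsupport fun h => ht (hsupp h)
    have h2 : deriv φ t = 0 := image_eq_zero_of_notMem_tsupport fun h =>
      ht (hsupp (tsupport_deriv_subset h))
    simp [hq, h1, h2]
  have hii : ∀ w : ℝ → ℝ, ContinuousOn w (Set.Icc 0 r) → ∀ p : ℝ → ℝ, Continuous p →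
      ∀ x, 0 ≤ x → x ≤ r → IntervalIntegrable (fun t => p t * w t) volume x r :=
    fun w hw p hp x hx hxr => ContinuousOn.intervalIntegrable_of_Icc hxr
      (hp.continuousOn.mul (hw.mono (Set.Icc_subset_Icc_left hx)))
  have hqint : ∀ w : ℝ → ℝ, ContinuousOn w (Set.Icc 0 r) → ∀ x, 0 ≤ x → x ≤ r →
      ∫ t in x..r, q t * w t =
        (∫ t in x..r, deriv φ t ^ 2 * w t) - Λ * ∫ t in x..r, φ t ^ 2 * w t := by
    intro w hw x hx hxr
    rw [← intervalIntegral.integral_const_mul, ← intervalIntegral.integral_sub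
      (hii w hw (fun t => deriv φ t ^ 2) (hφ'c.pow 2) x hx hxr)
      ((hii w hw (fun t => φ t ^ 2) (hφc.pow 2) x hx hxr).const_mul Λ)]
    refine intervalIntegral.integral_congr fun t _ => ?_
    simp only [hq]
    ring
  have hder : ∀ w : ℝ → ℝ, ContinuousOn w (Set.Icc 0 r) → ∀ x ∈ Set.Ioo 0 r,
      HasDerivAt (fun x => ∫ t in x..r, q t * w t) (-(q x * w x)) x := by
    intro w hw x hx
    have hc : ContinuousOn (fun t => q t * w t) (Set.Icc 0 r) := hqc.continuousOn.mul hw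
    exact intervalIntegral.integral_hasDerivAt_left (hii w hw q hqc x hx.1.le hx.2.le)
      ((hc.mono Set.Ioo_subset_Icc_self).stronglyMeasurableAtFilter isOpen_Ioo x hx)
      (hc.continuousAt (Icc_mem_nhds hx.1 hx.2))
  set F : ℝ → ℝ := fun x => ∫ t in x..r, q t * b t with hF
  have hF0 : ∀ x ∈ Set.Ioo 0 r, 0 ≤ F x := by
    intro x hx
    simp only [hF]
    rw [hqint b hbc x hx.1.le hx.2.le, sub_nonneg]
    exact tail_rayleigh_le hx.1 hx.2 hbc hb0 hbC hΛ0 hΛ hφ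
  set G : ℝ → ℝ := fun x => (∫ t in x..r, q t * a t) - a x / b x * F x with hG
  have hIcc : ∀ x ∈ Set.Icc α β, x ∈ Set.Ioo 0 r := fun x hx =>
    ⟨hα.trans_le hx.1, hx.2.trans_lt hβr⟩
  have hGd : ∀ x ∈ Set.Ioo 0 r, HasDerivAt G (-((A x - B x) * (a x / b x) * F x)) x := by
    intro x hx
    have hb := (hbpos x hx).ne'
    refine ((hder a hac x hx).sub
      (((had x hx).div (hbd x hx) hb).mul (hder b hbc x hx))).congr_deriv ?_
    simp only [Pi.div_apply]
    change _ - ((A x * a x * b x - a x * (B x * b x)) / b x ^ 2 * F x + _) = _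
    field_simp
    ring
  have hanti : AntitoneOn G (Set.Icc α β) := by
    refine antitoneOn_of_deriv_nonpos (convex_Icc α β)
      (fun x hx => (hGd x (hIcc x hx)).continuousAt.continuousWithinAt)
      (fun x hx => (hGd x (hIcc x (interior_subset hx))).differentiableAt.differentiableWithinAt)
      fun x hx => ?_
    have hx' := hIcc x (interior_subset hx)
    rw [(hGd x hx').deriv, neg_nonpos]
    have := sub_nonneg.2 (hBA x hx')
    have := ha0 x hx'
    have := hbpos x hx'
    have := hF0 x hx'
    positivity
  have hzero : ∀ w : ℝ → ℝ, ∫ t in β..r, q t * w t = 0 := by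
    intro w
    rw [intervalIntegral.integral_of_le hβr.le]
    exact setIntegral_eq_zero_of_forall_eq_zero fun t ht => by
      rw [hq0 t fun h => h.2.not_gt ht.1, zero_mul]
  have hGβ : G β = 0 := by simp only [hG, hF, hzero]; ring
  have hGα : 0 ≤ G α :=
    hGβ ▸ hanti (Set.left_mem_Icc.2 hαβ.le) (Set.right_mem_Icc.2 hαβ.le) hαβ.le
  have hα' := hIcc α (Set.left_mem_Icc.2 hαβ.le)
  have hpos : 0 ≤ a α / b α * F α :=
    mul_nonneg (div_nonneg (ha0 α hα').le (hbpos α hα').le) (hF0 α hα')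
  have hfull : ∫ t in (0 : ℝ)..r, q t * a t = ∫ t in α..r, q t * a t := by
    have hs : Function.support (fun t => q t * a t) ⊆ Set.Ioo α β := fun t ht => by
      by_contra h
      exact ht (by simp [hq0 t h])
    rw [intervalIntegral.integral_eq_integral_of_support_subset
        (hs.trans fun t ht => ⟨hα.trans ht.1, ht.2.le.trans hβr.le⟩),
      intervalIntegral.integral_eq_integral_of_support_subset
        (hs.trans fun t ht => ⟨ht.1, ht.2.le.trans hβr.le⟩)]
  have := hqint a hac 0 le_rfl hr.le
  simp only [hG] at hGα
  linarith

theorem IsTestFunction.integral_sq_mul_pos {r : ℝ} (hr : 0 < r) {φ b : ℝ → ℝ}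
    (h : IsTestFunction (Set.Ioo 0 r) φ) (hφ : φ ≠ 0) (hbc : ContinuousOn b (Set.Icc 0 r))
    (hbpos : ∀ t ∈ Set.Ioo 0 r, 0 < b t) :
    0 < ∫ t in (0 : ℝ)..r, φ t ^ 2 * b t := by
  obtain ⟨x, hx⟩ := Function.ne_iff.1 hφ
  have hx' : x ∈ Set.Ioo 0 r := h.tsupport_subset (subset_tsupport φ hx)
  have hc : ContinuousOn (fun t => φ t ^ 2 * b t) (Set.Icc 0 r) :=
    (h.contDiff.continuous.pow 2).continuousOn.mul hbc
  refine intervalIntegral.integral_pos hr hc (fun t ht => ?_) ⟨x, Set.Ioo_subset_Icc_self hx', ?_⟩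
  · by_cases ht' : t ∈ Set.Ioo 0 r
    · exact mul_nonneg (sq_nonneg _) (hbpos t ht').le
    · rw [image_eq_zero_of_notMem_tsupport fun hm => ht' (h.tsupport_subset hm)]
      simp
  · exact mul_pos (sq_pos_of_ne_zero hx) (hbpos x hx')

theorem exists_pow_le_mul_self {r : ℝ} (hr : 0 < r) {f : ℝ → ℝ}
    (hf : ContDiffOn ℝ (⊤ : ℕ∞) f (Set.Icc 0 r)) (hf0 : f 0 = 0)
    (hfpos : ∀ t ∈ Set.Ioc 0 r, 0 < f t) {k : ℕ} (hk : k ≠ 0) :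
    ∃ C, ∀ t ∈ Set.Icc 0 r, f t ^ k ≤ C * t := by
  obtain ⟨K, hK⟩ := isCompact_Icc.exists_bound_of_continuousOn
    (hf.continuousOn_derivWithin (uniqueDiffOn_Icc hr) (by simp))
  have h0 : (0 : ℝ) ∈ Set.Icc 0 r := Set.left_mem_Icc.2 hr.le
  have hK0 : 0 ≤ K := (norm_nonneg _).trans (hK 0 h0)
  obtain ⟨j, rfl⟩ := Nat.exists_eq_succ_of_ne_zero hk
  refine ⟨(K * r) ^ j * K, fun t ht => ?_⟩
  have hle : f t ≤ K * t := by
    have := (convex_Icc (0 : ℝ) r).norm_image_sub_le_of_norm_derivWithin_le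
      (hf.differentiableOn (by simp)) hK h0 ht
    rw [hf0, sub_zero, sub_zero, Real.norm_of_nonneg ht.1] at this
    exact (le_abs_self _).trans this
  have hft : 0 ≤ f t := by
    rcases ht.1.eq_or_lt with h | h
    · rw [← h, hf0]
    · exact (hfpos t ⟨h, ht.2⟩).le
  calc f t ^ (j + 1) = f t ^ j * f t := pow_succ _ _
    _ ≤ (K * r) ^ j * (K * t) := by
        refine mul_le_mul (pow_le_pow_left₀ hft (hle.trans ?_) _) hle hft (by positivity)
        exact mul_le_mul_of_nonneg_left ht.2 hK0
    _ = _ := by ring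

theorem hasDerivAt_pow_sub_one {r : ℝ} {f : ℝ → ℝ} (hf : ContDiffOn ℝ (⊤ : ℕ∞) f (Set.Icc 0 r))
    (hfpos : ∀ t ∈ Set.Ioc 0 r, 0 < f t) {n : ℕ} (hn : 2 ≤ n) {t : ℝ} (ht : t ∈ Set.Ioo 0 r) :
    HasDerivAt (fun t => f t ^ (n - 1))
      (((n : ℝ) - 1) * (derivWithin f (Set.Icc 0 r) t / f t) * f t ^ (n - 1)) t := by
  have hd : HasDerivAt f (derivWithin f (Set.Icc 0 r) t) t :=
    (hf.differentiableOn (by simp) t (Set.Ioo_subset_Icc_self ht)).hasDerivWithinAt.hasDerivAt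
      (Icc_mem_nhds ht.1 ht.2)
  obtain ⟨k, rfl⟩ := Nat.exists_eq_add_of_le hn
  have hft := (hfpos t ⟨ht.1, ht.2.le⟩).ne'
  rw [show 2 + k - 1 = k + 1 by lia]
  refine (hd.pow (k + 1)).congr_deriv ?_
  rw [Nat.add_sub_cancel]
  push_cast
  field_simp
  ring

theorem mu_le_mu_of_logDeriv_le {n m : ℕ} (hn : 2 ≤ n) (hm : 2 ≤ m) {r : ℝ} (hr : 0 < r)
    {f g : ℝ → ℝ} (hf : ContDiffOn ℝ (⊤ : ℕ∞) f (Set.Icc 0 r))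
    (hg : ContDiffOn ℝ (⊤ : ℕ∞) g (Set.Icc 0 r)) (hg0 : g 0 = 0)
    (hfpos : ∀ t ∈ Set.Ioc 0 r, 0 < f t) (hgpos : ∀ t ∈ Set.Ioc 0 r, 0 < g t)
    (h : ∀ t ∈ Set.Ioo 0 r,
      ((m : ℝ) - 1) * (derivWithin g (Set.Icc 0 r) t / g t) ≤
        ((n : ℝ) - 1) * (derivWithin f (Set.Icc 0 r) t / f t)) :
    mu m g (Set.Ioo 0 r) ≤ mu n f (Set.Ioo 0 r) := by
  have hset : ∀ u : ℝ → ℝ, ∫ t in Set.Ioo 0 r, u t = ∫ t in (0 : ℝ)..r, u t := fun u => by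
    rw [intervalIntegral.integral_of_le hr.le, integral_Ioc_eq_integral_Ioo]
  have hac : ContinuousOn (fun t => f t ^ (n - 1)) (Set.Icc 0 r) := hf.continuousOn.pow _
  have hbc : ContinuousOn (fun t => g t ^ (m - 1)) (Set.Icc 0 r) := hg.continuousOn.pow _
  have hapos : ∀ t ∈ Set.Ioo 0 r, 0 < f t ^ (n - 1) := fun t ht =>
    pow_pos (hfpos t ⟨ht.1, ht.2.le⟩) _
  have hbpos : ∀ t ∈ Set.Ioo 0 r, 0 < g t ^ (m - 1) := fun t ht =>
    pow_pos (hgpos t ⟨ht.1, ht.2.le⟩) _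
  have hb0 : ∀ t ∈ Set.Icc 0 r, 0 ≤ g t ^ (m - 1) := by
    intro t ht
    rcases ht.1.eq_or_lt with h | h
    · rw [← h, hg0]
      positivity
    · exact (pow_pos (hgpos t ⟨h, ht.2⟩) _).le
  obtain ⟨C, hC⟩ := exists_pow_le_mul_self hr hg hg0 hgpos (show m - 1 ≠ 0 by lia)
  have hnonneg : ∀ ψ : ℝ → ℝ, 0 ≤ ∫ t in (0 : ℝ)..r, ψ t ^ 2 * g t ^ (m - 1) := fun ψ =>
    intervalIntegral.integral_nonneg hr.le fun t ht => mul_nonneg (sq_nonneg _) (hb0 t ht)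
  have hlb : ∀ q ∈ { q : ℝ | ∃ φ : ℝ → ℝ, ContDiff ℝ (⊤ : ℕ∞) φ ∧ HasCompactSupport φ ∧
      tsupport φ ⊆ Set.Ioo 0 r ∧ φ ≠ 0 ∧
      q = (∫ t in Set.Ioo 0 r, deriv φ t ^ 2 * g t ^ (m - 1)) /
        ∫ t in Set.Ioo 0 r, φ t ^ 2 * g t ^ (m - 1) }, 0 ≤ q := by
    rintro q ⟨φ, -, -, -, -, rfl⟩
    rw [hset, hset]
    exact div_nonneg (hnonneg _) (hnonneg _)
  have hΛ0 : 0 ≤ mu m g (Set.Ioo 0 r) := Real.sInf_nonneg hlb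
  have hΛ : ∀ ψ, IsTestFunction (Set.Ioo 0 r) ψ →
      mu m g (Set.Ioo 0 r) * ∫ t in (0 : ℝ)..r, ψ t ^ 2 * g t ^ (m - 1) ≤
        ∫ t in (0 : ℝ)..r, deriv ψ t ^ 2 * g t ^ (m - 1) := by
    intro ψ hψ
    by_cases h0 : ψ = 0
    · simp [h0]
    · rw [← le_div_iff₀ (hψ.integral_sq_mul_pos hr h0 hbc hbpos)]
      refine csInf_le ⟨0, hlb⟩
        ⟨ψ, hψ.contDiff, hψ.hasCompactSupport, hψ.tsupport_subset, h0, ?_⟩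
      rw [hset, hset]
  refine le_csInf ?_ ?_
  · obtain ⟨φ, hsupp, hcomp, hsmooth, -, hone⟩ := exists_contDiff_tsupport_subset (n := (⊤ : ℕ∞))
      (Ioo_mem_nhds (half_pos hr) (half_lt_self hr))
    exact ⟨_, φ, hsmooth, hcomp, hsupp, fun h0 => by simp [h0] at hone, rfl⟩
  · rintro q ⟨φ, hφs, hφc, hφt, hφ0, rfl⟩
    have hφ : IsTestFunction (Set.Ioo 0 r) φ := ⟨hφs, hφc, hφt⟩
    rw [hset, hset, le_div_iff₀ (hφ.integral_sq_mul_pos hr hφ0 hac hapos)]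
    exact rayleigh_le_of_logDeriv_le hr hac hbc hapos hbpos hb0
      (fun t ht => hasDerivAt_pow_sub_one hf hfpos hn ht)
      (fun t ht => hasDerivAt_pow_sub_one hg hgpos hm ht) h hC hΛ0 hΛ hφ

/-- Theorem 3.1 for rotationally symmetric metrics: let `f, g : [0,r] → ℝ`
be smooth with `f(0) = g(0) = 0`, `f'(0) = g'(0) = 1`, `f, g > 0` on `(0,r]`.
If `(n-1)f'/f ≥ (m-1)g'/g` on `(0,r)` then `μ_n(f, r) ≥ μ_m(g, r)`; if
`(n-1)f'/f ≤ (m-1)g'/g` on `(0,r)` then `μ_n(f, r) ≤ μ_m(g, r)`. -/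
theorem stmt7 (n m : ℕ) (hn : 2 ≤ n) (hm : 2 ≤ m) (r : ℝ) (hr : 0 < r)
    (f g : ℝ → ℝ) (hf : ContDiffOn ℝ (⊤ : ℕ∞) f (Set.Icc 0 r)) (hg : ContDiffOn ℝ (⊤ : ℕ∞) g (Set.Icc 0 r))
    (hf0 : f 0 = 0) (hg0 : g 0 = 0)
    (hf'0 : derivWithin f (Set.Icc 0 r) 0 = 1) (hg'0 : derivWithin g (Set.Icc 0 r) 0 = 1)
    (hfpos : ∀ t ∈ Set.Ioc 0 r, 0 < f t) (hgpos : ∀ t ∈ Set.Ioc 0 r, 0 < g t) :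
    ((∀ t ∈ Set.Ioo 0 r,
        ((m : ℝ) - 1) * (derivWithin g (Set.Icc 0 r) t / g t) ≤
          ((n : ℝ) - 1) * (derivWithin f (Set.Icc 0 r) t / f t)) →
        mu m g (Set.Ioo 0 r) ≤ mu n f (Set.Ioo 0 r)) ∧
    ((∀ t ∈ Set.Ioo 0 r,
        ((n : ℝ) - 1) * (derivWithin f (Set.Icc 0 r) t / f t) ≤
          ((m : ℝ) - 1) * (derivWithin g (Set.Icc 0 r) t / g t)) →
        mu n f (Set.Ioo 0 r) ≤ mu m g (Set.Ioo 0 r)) := by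
  exact ⟨mu_le_mu_of_logDeriv_le hn hm hr hf hg hg0 hfpos hgpos,
    mu_le_mu_of_logDeriv_le hm hn hr hg hf hf0 hgpos hfpos⟩
end

section
/- Let n ≥ 2 and m ≥ 2 be integers and let 0 < r < ∞. Let f, g : [0, r] → ℝ be smooth with f(0) = g(0) = 0, f′(0) = g′(0) = 1, and f(t) > 0, g(t) > 0 for all t ∈ (0, r]. Suppose that either (n−1)f′(t)/f(t) ≥ (m−1)g′(t)/g(t) for all t ∈ (0, r), or (n−1)f′(t)/f(t) ≤ (m−1)g′(t)/g(t) for all t ∈ (0, r). If μ_n(f, r) = μ_m(g, r), then n = m and f(t) = g(t) for all t ∈ [0, r]. -/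
open scoped ENNReal Topology
open MeasureTheory

open Set Filter

section FundamentalTone

lemma mu_congr_weight {n k : ℕ} {w v : ℝ → ℝ} {s : Set ℝ} (hs : MeasurableSet s)
    (h : ∀ t ∈ s, w t ^ (n - 1) = v t ^ (k - 1)) : mu n w s = mu k v s := by
  have h₁ (φ : ℝ → ℝ) : ∫ t in s, φ t ^ 2 * w t ^ (n - 1) = ∫ t in s, φ t ^ 2 * v t ^ (k - 1) :=
    setIntegral_congr_fun hs fun t ht => by simp only [h t ht]
  unfold mu
  simp only [h₁]

lemma mu_mul_le {p : ℝ → ℝ} {s : Set ℝ} (hs : MeasurableSet s) (hp : ∀ t ∈ s, 0 ≤ p t)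
    {φ : ℝ → ℝ} (hφ : ContDiff ℝ (⊤ : ℕ∞) φ) (hc : HasCompactSupport φ) (ht : tsupport φ ⊆ s) :
    mu 2 p s * ∫ t in s, φ t ^ 2 * p t ≤ ∫ t in s, deriv φ t ^ 2 * p t := by
  have hnn (ψ : ℝ → ℝ) : 0 ≤ ∫ t in s, ψ t ^ 2 * p t :=
    setIntegral_nonneg hs fun t ht => mul_nonneg (sq_nonneg _) (hp t ht)
  rcases (hnn φ).eq_or_lt with h0 | h0
  · rw [← h0, mul_zero]; exact hnn _
  have hne : φ ≠ 0 := by rintro rfl; simp at h0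
  rw [← le_div_iff₀ h0]
  refine csInf_le ⟨0, ?_⟩ ⟨φ, hφ, hc, ht, hne, by simp⟩
  rintro _ ⟨ψ, -, -, -, -, rfl⟩
  simpa using div_nonneg (hnn (deriv ψ)) (hnn ψ)

lemma mu_nonneg {p : ℝ → ℝ} {s : Set ℝ} (hs : MeasurableSet s) (hp : ∀ t ∈ s, 0 ≤ p t) :
    0 ≤ mu 2 p s := by
  have hnn (ψ : ℝ → ℝ) : 0 ≤ ∫ t in s, ψ t ^ 2 * p t :=
    setIntegral_nonneg hs fun t ht => mul_nonneg (sq_nonneg _) (hp t ht)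
  refine Real.sInf_nonneg ?_
  rintro _ ⟨ψ, -, -, -, -, rfl⟩
  simpa using div_nonneg (hnn (deriv ψ)) (hnn ψ)

lemma le_mu {p : ℝ → ℝ} {s : Set ℝ} (hs : IsOpen s) (hne : s.Nonempty) (hpc : Continuous p)
    (hp : ∀ t ∈ s, 0 < p t) {κ : ℝ}
    (h : ∀ φ : ℝ → ℝ, ContDiff ℝ (⊤ : ℕ∞) φ → HasCompactSupport φ → tsupport φ ⊆ s →
      κ * ∫ t in s, φ t ^ 2 * p t ≤ ∫ t in s, deriv φ t ^ 2 * p t) :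
    κ ≤ mu 2 p s := by
  refine le_csInf ?_ ?_
  · obtain ⟨x, hx⟩ := hne
    obtain ⟨φ, h1, h2, h3, -, h4⟩ :=
      exists_contDiff_tsupport_subset (n := (⊤ : ℕ∞)) (hs.mem_nhds hx)
    exact ⟨_, φ, h3, h2, h1, fun h0 => by simp [h0] at h4, rfl⟩
  · rintro _ ⟨φ, h1, h2, h3, h4, rfl⟩
    have hpos : 0 < ∫ t in s, φ t ^ 2 * p t := by
      have hcont : Continuous fun t => φ t ^ 2 * p t := (h1.continuous.pow 2).mul hpc
      have hsupp : Function.support (fun t => φ t ^ 2 * p t) ⊆ tsupport φ := fun t ht =>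
        subset_tsupport φ fun h0 => ht (by simp [h0])
      rw [setIntegral_eq_integral_of_forall_compl_eq_zero fun t ht => by
        by_contra h0; exact ht (h3 (hsupp h0))]
      obtain ⟨x, hx⟩ := Function.ne_iff.1 h4
      have hxs : x ∈ s := h3 (subset_tsupport φ hx)
      refine hcont.integral_pos_of_hasCompactSupport_nonneg_nonzero
        (HasCompactSupport.of_support_subset_isCompact h2 hsupp) (fun t => ?_) (x := x)
        (mul_pos (sq_pos_iff.2 hx) (hp x hxs)).ne'
      by_cases ht : t ∈ s
      · exact mul_nonneg (sq_nonneg _) (hp t ht).le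
      · have : φ t = 0 := by by_contra h0; exact ht (h3 (subset_tsupport φ h0))
        simp [this]
    simp only [Nat.add_one_sub_one, pow_one]
    rw [le_div_iff₀ hpos]
    exact h φ h1 h2 h3

/-- A Barta-type lower bound, in terms of the flux `V = -p u' / u` of a positive supersolution. -/
lemma le_mu_of_flux {p V V' : ℝ → ℝ} {s : Set ℝ} (hs : IsOpen s) (hne : s.Nonempty)
    (hpc : Continuous p) (hp : ∀ t ∈ s, 0 < p t) (hV : ∀ t ∈ s, HasDerivAt V (V' t) t)
    (hV' : ContinuousOn V' s) {κ : ℝ} (h : ∀ t ∈ s, κ * p t ≤ V' t - V t ^ 2 / p t) :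
    κ ≤ mu 2 p s := by
  refine le_mu hs hne hpc hp fun φ h1 h2 h3 => ?_
  have hdφ : Continuous (deriv φ) := h1.continuous_deriv (by simp)
  have hzero : ∀ t ∉ s, φ t = 0 ∧ deriv φ t = 0 := fun t ht => by
    refine ⟨image_eq_zero_of_notMem_tsupport fun h0 => ht (h3 h0), ?_⟩
    by_contra h0
    exact ht (h3 (support_deriv_subset h0))
  set G : ℝ → ℝ := fun t => 2 * φ t * deriv φ t * V t + φ t ^ 2 * V' t with hG
  have hVc : ContinuousOn V s := fun t ht => (hV t ht).continuousAt.continuousWithinAt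
  have hder : ∀ t, HasDerivAt (fun t => φ t ^ 2 * V t) (G t) t := by
    intro t
    by_cases ht : t ∈ tsupport φ
    · have hφ : HasDerivAt φ (deriv φ t) t := (h1.differentiable (by simp) t).hasDerivAt
      convert! (hφ.pow 2).mul (hV t (h3 ht)) using 1
      simp [hG]
    · have he : (fun t => φ t ^ 2 * V t) =ᶠ[𝓝 t] fun _ => 0 := by
        filter_upwards [(isClosed_tsupport φ).isOpen_compl.mem_nhds ht] with y hy
        simp [image_eq_zero_of_notMem_tsupport hy]
      have h0 : G t = 0 := by simp [hG, image_eq_zero_of_notMem_tsupport ht]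
      rw [h0]
      exact (hasDerivAt_const t (0 : ℝ)).congr_of_eventuallyEq he
  have hcont : Continuous fun t => φ t ^ 2 * V t :=
    continuous_iff_continuousAt.2 fun t => (hder t).continuousAt
  have hGc : Continuous G := by
    rw [continuous_iff_continuousAt]
    intro t
    by_cases ht : t ∈ tsupport φ
    · have hm := hs.mem_nhds (h3 ht)
      have := hVc.continuousAt hm
      have := hV'.continuousAt hm
      have := h1.continuous.continuousAt (x := t)
      have := hdφ.continuousAt (x := t)
      fun_prop
    · have he : G =ᶠ[𝓝 t] fun _ => 0 := by
        filter_upwards [(isClosed_tsupport φ).isOpen_compl.mem_nhds ht] with y hy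
        simp [hG, image_eq_zero_of_notMem_tsupport hy]
      exact continuousAt_const.congr he.symm
  have hint (F : ℝ → ℝ) (hF : Continuous F) (hF0 : ∀ t ∉ tsupport φ, F t = 0) : Integrable F :=
    hF.integrable_of_hasCompactSupport
      (HasCompactSupport.of_support_subset_isCompact h2 fun t ht => by
        by_contra h0; exact ht (hF0 t h0))
  have hdφ0 : ∀ t ∉ tsupport φ, deriv φ t = 0 := fun t ht => by
    by_contra h0
    exact ht (support_deriv_subset h0)
  have hφ0 : ∀ t ∉ tsupport φ, φ t = 0 := fun t ht => image_eq_zero_of_notMem_tsupport ht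
  have hI0 : ∫ t, G t = 0 := integral_eq_zero_of_hasDerivAt_of_integrable hder
    (hint _ hGc fun t ht => by simp [hG, hφ0 t ht]) (hint _ hcont fun t ht => by simp [hφ0 t ht])
  have hφc := h1.continuous
  rw [setIntegral_eq_integral_of_forall_compl_eq_zero fun t ht => by simp [hzero t ht],
    setIntegral_eq_integral_of_forall_compl_eq_zero fun t ht => by simp [hzero t ht],
    ← integral_const_mul]
  have hi1 : Integrable fun t => κ * (φ t ^ 2 * p t) :=
    hint _ (by fun_prop) fun t ht => by simp [hφ0 t ht]
  have hi2 : Integrable fun t => deriv φ t ^ 2 * p t :=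
    hint _ (by fun_prop) fun t ht => by simp [hdφ0 t ht]
  have hi3 : Integrable G := hint _ hGc fun t ht => by simp [hG, hφ0 t ht]
  have := integral_mono hi1 (hi2.add hi3) fun t => ?_
  · rwa [integral_add' hi2 hi3, hI0, add_zero] at this
  by_cases ht : t ∈ s
  · have hpt := hp t ht
    have h5 := mul_le_mul_of_nonneg_left (h t ht) (sq_nonneg (φ t))
    have h6 : 0 ≤ p t * (deriv φ t + φ t * V t / p t) ^ 2 := by positivity
    have h7 : p t * (deriv φ t + φ t * V t / p t) ^ 2 =
      deriv φ t ^ 2 * p t + 2 * φ t * deriv φ t * V t + φ t ^ 2 * (V t ^ 2 / p t) := by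
      field_simp
      ring
    simp only [Pi.add_apply, hG]
    nlinarith
  · simp [hG, hzero t ht]

end FundamentalTone

/-- Weights on `(0, ∞)` that vanish at least linearly at `0` and are almost monotone. -/
structure ConicalWeight (p : ℝ → ℝ) (C : ℝ) : Prop where
  continuous : Continuous p
  pos : ∀ t, 0 < t → 0 < p t
  eq_zero : ∀ t ≤ 0, p t = 0
  le_mul : ∀ s t, 0 ≤ s → s ≤ t → p s ≤ C * p t
  le_linear : ∀ t, 0 ≤ t → p t ≤ C * t

namespace ConicalWeight

variable {p : ℝ → ℝ} {C : ℝ}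

lemma nonneg (hp : ConicalWeight p C) (t : ℝ) : 0 ≤ p t := by
  rcases le_or_gt t 0 with h | h
  · rw [hp.eq_zero t h]
  · exact (hp.pos t h).le

lemma const_pos (hp : ConicalWeight p C) : 0 < C := by
  have h1 := hp.le_linear 1 zero_le_one
  have h2 := hp.pos 1 one_pos
  linarith

/-- The averaged mass `(∫₀ᵗ p u) / p(t)`. -/
noncomputable def average (p u : ℝ → ℝ) (t : ℝ) : ℝ := (∫ s in (0 : ℝ)..t, p s * u s) / p t

lemma hasDerivAt_mass (hp : ConicalWeight p C) {u : ℝ → ℝ} (hu : Continuous u) (t : ℝ) :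
    HasDerivAt (fun t => ∫ s in (0 : ℝ)..t, p s * u s) (p t * u t) t :=
  (hp.continuous.mul hu).integral_hasStrictDerivAt 0 t |>.hasDerivAt

lemma average_eq_zero (hp : ConicalWeight p C) (u : ℝ → ℝ) {t : ℝ} (ht : t ≤ 0) :
    average p u t = 0 := by simp [average, hp.eq_zero t ht]

lemma mul_average (hp : ConicalWeight p C) (u : ℝ → ℝ) {t : ℝ} (ht : 0 ≤ t) :
    p t * average p u t = ∫ s in (0 : ℝ)..t, p s * u s := by
  rcases ht.eq_or_lt with rfl | h
  · simp [hp.eq_zero]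
  · exact mul_div_cancel₀ _ (hp.pos t h).ne'

lemma abs_average_le (hp : ConicalWeight p C) {u v : ℝ → ℝ} (hv : Continuous v)
    {t : ℝ} (ht : 0 ≤ t) (huv : ∀ s ∈ Icc 0 t, |u s| ≤ v s) :
    |average p u t| ≤ C * ∫ s in (0 : ℝ)..t, v s := by
  rcases ht.eq_or_lt with rfl | h
  · simp [hp.average_eq_zero]
  rw [average, abs_div, abs_of_pos (hp.pos t h), div_le_iff₀ (hp.pos t h)]
  have h1 : |∫ s in (0 : ℝ)..t, p s * u s| ≤ ∫ s in (0 : ℝ)..t, (C * p t) * v s := by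
    rw [← Real.norm_eq_abs]
    refine intervalIntegral.norm_integral_le_of_norm_le ht (.of_forall fun s hs => ?_)
      (Continuous.intervalIntegrable (by fun_prop) _ _)
    have hs' : s ∈ Icc 0 t := ⟨hs.1.le, hs.2⟩
    rw [Real.norm_eq_abs, abs_mul, abs_of_nonneg (hp.nonneg s)]
    have h2 := hp.le_mul s t hs.1.le hs.2
    exact mul_le_mul h2 (huv s hs') (abs_nonneg _)
      (by have := hp.const_pos; have := hp.nonneg t; positivity)
  rw [intervalIntegral.integral_const_mul] at h1
  linarith

lemma continuous_average (hp : ConicalWeight p C) {u : ℝ → ℝ} (hu : Continuous u) :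
    Continuous (average p u) := by
  rw [continuous_iff_continuousAt]
  intro t
  rcases lt_trichotomy t 0 with h | rfl | h
  · have : average p u =ᶠ[𝓝 t] fun _ => 0 := by
      filter_upwards [Iio_mem_nhds h] with s hs using hp.average_eq_zero u (le_of_lt hs)
    exact continuousAt_const.congr this.symm
  · have hb : ∀ t, |average p u t| ≤ |C * ∫ s in (0 : ℝ)..t, (|u s|)| := by
      intro t
      rcases le_or_gt t 0 with h | h
      · rw [hp.average_eq_zero u h, abs_zero]; exact abs_nonneg _
      · exact (hp.abs_average_le hu.abs h.le fun s _ => le_rfl).trans (le_abs_self _)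
    have h0 : average p u 0 = 0 := hp.average_eq_zero u le_rfl
    rw [ContinuousAt, h0]
    refine squeeze_zero_norm hb ?_
    have hc : Continuous fun t => |C * ∫ s in (0 : ℝ)..t, (|u s|)| :=
      (continuous_const.mul (intervalIntegral.continuous_primitive
        (fun a b => hu.abs.intervalIntegrable a b) 0)).abs
    simpa using hc.tendsto 0
  · exact (hp.hasDerivAt_mass hu t).continuousAt.div hp.continuous.continuousAt (hp.pos t h).ne'

lemma average_sub (hp : ConicalWeight p C) {u v : ℝ → ℝ} (hu : Continuous u) (hv : Continuous v)
    (t : ℝ) : average p u t - average p v t = average p (fun s => u s - v s) t := by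
  unfold average
  have := hp.continuous
  rw [← sub_div, ← intervalIntegral.integral_sub
    (Continuous.intervalIntegrable (by fun_prop) _ _)
    (Continuous.intervalIntegrable (by fun_prop) _ _)]
  simp only [mul_sub]

lemma integral_exp_le {M t : ℝ} (hM : 0 < M) :
    ∫ s in (0 : ℝ)..t, Real.exp (M * s) ≤ Real.exp (M * t) / M := by
  rw [intervalIntegral.integral_comp_mul_left (fun x => Real.exp x) hM.ne', integral_exp,
    smul_eq_mul, mul_zero, Real.exp_zero, div_eq_inv_mul]
  have : 0 < M⁻¹ := inv_pos.2 hM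
  nlinarith

/-- The radial solution of `p u' = -κ ∫₀ᵗ p u` with `u(0) = 1` exists on `[0, r]`. -/
lemma exists_radial_solution (hp : ConicalWeight p C) {r : ℝ} (hr : 0 < r) (κ : ℝ) :
    ∃ u : ℝ → ℝ, Continuous u ∧ u 0 = 1 ∧
      ∀ t ∈ Ioo 0 r, HasDerivAt u (-κ * average p u t) t := by
  have hC := hp.const_pos
  obtain ⟨M, hM, hMκ⟩ : ∃ M : ℝ, 0 < M ∧ |κ| * C / M ^ 2 ≤ 1 / 2 := by
    refine ⟨1 + 2 * |κ| * C, by positivity, ?_⟩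
    have : 0 ≤ |κ| * C := by positivity
    rw [div_le_iff₀ (by positivity)]
    nlinarith
  let E : C(Icc 0 r, ℝ) → ℝ → ℝ := fun y t => Real.exp (M * t) * IccExtend hr.le y t
  have hE (y) : Continuous (E y) := by
    have := y.continuous.Icc_extend' (h := hr.le)
    fun_prop
  have hAint (y) : Continuous fun t => ∫ s in (0 : ℝ)..t, average p (E y) s :=
    intervalIntegral.continuous_primitive
      (fun a b => (hp.continuous_average (hE y)).intervalIntegrable a b) 0
  let F : C(Icc 0 r, ℝ) → C(Icc 0 r, ℝ) := fun y =>
    ⟨fun t => Real.exp (-(M * t)) * (1 - κ * ∫ s in (0 : ℝ)..t, average p (E y) s), by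
      have : Continuous fun t : Icc 0 r => ∫ s in (0 : ℝ)..t, average p (E y) s :=
        (hAint y).comp continuous_subtype_val
      fun_prop⟩
  have hF : ContractingWith (1 / 2) F := by
    refine ⟨by norm_num [← NNReal.coe_lt_coe], LipschitzWith.of_dist_le_mul fun y z => ?_⟩
    rw [ContinuousMap.dist_le (by positivity)]
    intro t
    have ht := t.2
    set d := dist y z
    have hd : 0 ≤ d := dist_nonneg
    have hEE : ∀ s, |E y s - E z s| ≤ d * Real.exp (M * s) := fun s => by
      simp only [E, IccExtend, Function.comp]
      rw [← mul_sub, abs_mul, abs_of_pos (Real.exp_pos _), mul_comm]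
      gcongr
      exact ContinuousMap.dist_apply_le_dist (f := y) (g := z) _
    have h1 : ∀ s ∈ Icc 0 r, |average p (E y) s - average p (E z) s| ≤
        C * d / M * Real.exp (M * s) := fun s hs => by
      rw [hp.average_sub (hE y) (hE z)]
      refine (hp.abs_average_le (v := fun s => d * Real.exp (M * s)) (by fun_prop) hs.1
        fun s _ => hEE s).trans ?_
      rw [intervalIntegral.integral_const_mul]
      have := integral_exp_le (t := s) hM
      calc _ ≤ C * (d * (Real.exp (M * s) / M)) := by gcongr
        _ = _ := by ring
    have h2 : |∫ s in (0 : ℝ)..t, (average p (E y) s - average p (E z) s)| ≤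
        C * d / M * (Real.exp (M * t) / M) := by
      rw [← Real.norm_eq_abs]
      refine (intervalIntegral.norm_integral_le_of_norm_le ht.1
        (.of_forall fun s hs => h1 s ⟨hs.1.le, hs.2.trans ht.2⟩)
        (Continuous.intervalIntegrable (by fun_prop) _ _)).trans ?_
      rw [intervalIntegral.integral_const_mul]
      gcongr
      exact integral_exp_le hM
    rw [intervalIntegral.integral_sub
      ((hp.continuous_average (hE y)).intervalIntegrable _ _)
      ((hp.continuous_average (hE z)).intervalIntegrable _ _)] at h2
    have h3 : F y t - F z t = -κ * Real.exp (-(M * t)) * ((∫ s in (0 : ℝ)..t, average p (E y) s) -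
        ∫ s in (0 : ℝ)..t, average p (E z) s) := by
      simp only [F, ContinuousMap.coe_mk]
      ring
    rw [Real.dist_eq, h3, abs_mul, abs_mul, abs_neg, abs_of_pos (Real.exp_pos _)]
    calc _ ≤ |κ| * Real.exp (-(M * t)) * (C * d / M * (Real.exp (M * t) / M)) := by gcongr
      _ = |κ| * C / M ^ 2 * d := by
        rw [Real.exp_neg]
        field_simp
      _ ≤ _ := by
        simp only [NNReal.coe_div, NNReal.coe_one, NNReal.coe_ofNat]
        gcongr
  obtain ⟨y, hy⟩ : ∃ y, F y = y := ⟨_, hF.fixedPoint_isFixedPt⟩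
  have hyt : ∀ t ∈ Icc 0 r, E y t = 1 - κ * ∫ s in (0 : ℝ)..t, average p (E y) s := fun t ht => by
    have h1 : y ⟨t, ht⟩ = Real.exp (-(M * t)) * (1 - κ * ∫ s in (0 : ℝ)..t, average p (E y) s) := by
      conv_lhs => rw [← hy]
      rfl
    simp only [E]
    rw [IccExtend_of_mem _ _ ht, h1, ← mul_assoc, ← Real.exp_add]
    simp [E]
  refine ⟨E y, hE y, by simpa using hyt 0 ⟨le_rfl, hr.le⟩, fun t ht => ?_⟩
  have h1 : HasDerivAt (fun t => 1 - κ * ∫ s in (0 : ℝ)..t, average p (E y) s)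
      (-κ * average p (E y) t) t := by
    have := ((hp.continuous_average (hE y)).integral_hasStrictDerivAt 0 t).hasDerivAt
    simpa using (this.const_mul κ).const_sub 1
  refine h1.congr_of_eventuallyEq ?_
  filter_upwards [Icc_mem_nhds ht.1 ht.2] with s hs using hyt s hs

end ConicalWeight

section TrialFunctions

lemma sq_intervalIntegral_le {e : ℝ → ℝ} {t : ℝ} (ht : 0 ≤ t)
    (h1 : IntervalIntegrable e volume 0 t) (h2 : IntervalIntegrable (fun s => e s ^ 2) volume 0 t) :
    (∫ s in (0 : ℝ)..t, e s) ^ 2 ≤ t * ∫ s in (0 : ℝ)..t, e s ^ 2 := by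
  rcases ht.eq_or_lt with rfl | h
  · simp
  set I := ∫ s in (0 : ℝ)..t, e s
  have h0 : 0 ≤ ∫ s in (0 : ℝ)..t, (e s - I / t) ^ 2 :=
    intervalIntegral.integral_nonneg ht fun _ _ => sq_nonneg _
  have h3 : ∫ s in (0 : ℝ)..t, (e s - I / t) ^ 2 =
      (∫ s in (0 : ℝ)..t, e s ^ 2) - 2 * (I / t) * I + (I / t) ^ 2 * t := by
    have : ∀ s, (e s - I / t) ^ 2 = e s ^ 2 - 2 * (I / t) * e s + (I / t) ^ 2 := fun s => by ring
    simp only [this]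
    rw [intervalIntegral.integral_add (h2.sub (h1.const_mul _)) (by simp),
      intervalIntegral.integral_sub h2 (h1.const_mul _), intervalIntegral.integral_const_mul]
    simp only [intervalIntegral.integral_const, sub_zero, smul_eq_mul, I]
    ring
  have h4 : (∫ s in (0 : ℝ)..t, e s ^ 2) - 2 * (I / t) * I + (I / t) ^ 2 * t =
      (∫ s in (0 : ℝ)..t, e s ^ 2) - I ^ 2 / t := by
    field_simp
    ring
  rw [h3, h4, sub_nonneg, div_le_iff₀ h] at h0
  linarith

lemma intervalIntegrable_of_bounded {d : ℝ → ℝ} (hd : Measurable d) {B : ℝ} (hB : ∀ t, |d t| ≤ B)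
    (a b : ℝ) : IntervalIntegrable d volume a b := by
  rw [intervalIntegrable_iff]
  exact Measure.integrableOn_of_bounded (M := B) measure_Ioc_lt_top.ne hd.aestronglyMeasurable
    (.of_forall fun t => hB t)

lemma exists_smooth_sq_integral_sub_le {d : ℝ → ℝ} (hd : MemLp d 2) {δ : ℝ} (hδ : 0 < δ) :
    ∃ g : ℝ → ℝ, HasCompactSupport g ∧ ContDiff ℝ (⊤ : ℕ∞) g ∧ ∫ t, (d t - g t) ^ 2 ≤ δ := by
  obtain ⟨g, h1, h2, h3⟩ := hd.exist_eLpNorm_sub_le (by simp) (by simp) (Real.sqrt_pos.2 hδ)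
  refine ⟨g, h1, h2, ?_⟩
  have hm : MemLp (d - g) 2 := hd.sub (h2.continuous.memLp_of_hasCompactSupport h1)
  rw [hm.eLpNorm_eq_integral_rpow_norm (by simp) (by simp),
    ENNReal.ofReal_le_ofReal_iff (Real.sqrt_nonneg _)] at h3
  simp only [ENNReal.toReal_ofNat, Real.rpow_ofNat, Pi.sub_apply, Real.norm_eq_abs, sq_abs] at h3
  rw [← one_div, ← Real.sqrt_eq_rpow] at h3
  exact (Real.sqrt_le_sqrt_iff hδ.le).1 h3

/-- Mean-zero bounded functions supported in `[a, b] ⊂ (0, r)` are `L²`-limits of derivatives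
of test functions on `(0, r)`. -/
lemma exists_testFunction_deriv_near {r a b : ℝ} (ha : 0 < a) (hab : a < b) (hb : b < r)
    {d : ℝ → ℝ} (hd : Measurable d) {B : ℝ} (hB : ∀ t, |d t| ≤ B)
    (hd0 : ∀ t ∉ Icc a b, d t = 0) (hI : ∫ t in (0 : ℝ)..r, d t = 0) {δ : ℝ} (hδ : 0 < δ) :
    ∃ φ : ℝ → ℝ, ContDiff ℝ (⊤ : ℕ∞) φ ∧ HasCompactSupport φ ∧ tsupport φ ⊆ Ioo 0 r ∧
      ∫ t in (0 : ℝ)..r, (deriv φ t - d t) ^ 2 ≤ δ := by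
  have hr : 0 < r := by linarith
  obtain ⟨ρ, hρ, hρa, hρb⟩ : ∃ ρ, 0 < ρ ∧ ρ < a ∧ b + ρ < r := by
    refine ⟨min a (r - b) / 2, ?_, ?_, ?_⟩
    · have : 0 < min a (r - b) := lt_min ha (by linarith)
      linarith
    · have := min_le_left a (r - b)
      linarith
    · have := min_le_right a (r - b)
      linarith
  let χ : ContDiffBump ((a + b) / 2) := ⟨(b - a) / 2, (b - a) / 2 + ρ, by linarith, by linarith⟩
  have hball : Metric.ball ((a + b) / 2) ((b - a) / 2 + ρ) = Ioo (a - ρ) (b + ρ) := by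
    rw [Real.ball_eq_Ioo]; congr 1 <;> ring
  have hcball : Metric.closedBall ((a + b) / 2) ((b - a) / 2) = Icc a b := by
    rw [Real.closedBall_eq_Icc]; congr 1 <;> ring
  have hχ0 : ∀ t ∉ Ioo (a - ρ) (b + ρ), χ t = 0 := fun t ht => by
    by_contra h
    have h' : t ∈ Function.support χ := h
    rw [χ.support_eq] at h'
    exact ht (hball ▸ h')
  have hχ1 : ∀ t ∈ Icc a b, χ t = 1 := fun t ht => χ.one_of_mem_closedBall (hcball ▸ ht)
  set η : ℝ → ℝ := χ.normed volume
  have hηs : ContDiff ℝ (⊤ : ℕ∞) η := χ.contDiff_normed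
  have hη0 : ∀ t ∉ Ioo (a - ρ) (b + ρ), η t = 0 := fun t ht => by
    simp [η, ContDiffBump.normed, hχ0 t ht]
  have hηI : ∫ t in (0 : ℝ)..r, η t = 1 := by
    rw [intervalIntegral.integral_eq_integral_of_support_subset, χ.integral_normed]
    intro t ht
    by_contra h
    exact ht (hη0 t fun h' => h ⟨by linarith [h'.1], by linarith [h'.2]⟩)
  have hηc := hηs.continuous
  set J := ∫ t in (0 : ℝ)..r, η t ^ 2
  have hJ : 0 ≤ J := intervalIntegral.integral_nonneg hr.le fun _ _ => sq_nonneg _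
  have hdL : MemLp d 2 := by
    have h1 : MemLp d 2 (volume.restrict (Icc a b)) :=
      MemLp.of_bound hd.aestronglyMeasurable B (.of_forall fun t => hB t)
    rw [← memLp_indicator_iff_restrict measurableSet_Icc] at h1
    refine h1.ae_eq (.of_forall fun t => ?_)
    by_cases ht : t ∈ Icc a b
    · simp [ht]
    · simp [ht, hd0 t ht]
  set δ' := δ / (2 + 2 * r * J) with hδ'
  have hδ'p : 0 < δ' := by positivity
  obtain ⟨g, hg1, hg2, hg3⟩ := exists_smooth_sq_integral_sub_le hdL hδ'p
  have hgc := hg2.continuous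
  have hχc := χ.continuous
  -- the error before correcting the mean
  set e : ℝ → ℝ := fun t => χ t * g t - d t with he
  obtain ⟨Bg, hBg⟩ : ∃ Bg, ∀ t, |g t| ≤ Bg := by
    obtain ⟨Bg, h⟩ := hgc.bounded_above_of_compact_support hg1
    exact ⟨Bg, h⟩
  have heB : ∀ t, |e t| ≤ Bg + B := fun t => by
    refine (abs_sub _ _).trans (add_le_add ?_ (hB t))
    rw [abs_mul, abs_of_nonneg χ.nonneg]
    exact (mul_le_of_le_one_left (abs_nonneg _) χ.le_one).trans (hBg t)
  have hem : Measurable e := (hχc.mul hgc).measurable.sub hd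
  have hei := intervalIntegrable_of_bounded hem heB 0 r
  have he2i : IntervalIntegrable (fun t => e t ^ 2) volume 0 r := by
    refine intervalIntegrable_of_bounded (hem.pow_const 2) (B := (Bg + B) ^ 2) (fun t => ?_) 0 r
    rw [abs_pow]
    exact pow_le_pow_left₀ (abs_nonneg _) (heB t) 2
  have heI : ∫ t in (0 : ℝ)..r, e t ^ 2 ≤ δ' := by
    refine le_trans ?_ hg3
    have hi : Integrable fun t => (d t - g t) ^ 2 :=
      (hdL.sub (hgc.memLp_of_hasCompactSupport hg1)).integrable_sq
    rw [intervalIntegral.integral_of_le hr.le]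
    refine (setIntegral_mono he2i.1 hi.integrableOn fun t => ?_).trans
      (setIntegral_le_integral hi (.of_forall fun t => sq_nonneg _))
    have h1 : e t = χ t * (g t - d t) := by
      by_cases ht : t ∈ Icc a b
      · simp [he, hχ1 t ht]
      · simp [he, hd0 t ht]
    simp only [h1]
    rw [mul_pow, ← neg_sub (d t), neg_sq]
    exact mul_le_of_le_one_left (sq_nonneg _) (pow_le_one₀ χ.nonneg χ.le_one)
  set c := ∫ t in (0 : ℝ)..r, χ t * g t with hc
  have hce : c = ∫ t in (0 : ℝ)..r, e t := by
    rw [he, intervalIntegral.integral_sub (Continuous.intervalIntegrable (by fun_prop) _ _)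
      (intervalIntegrable_of_bounded hd hB 0 r), hI, sub_zero]
  have hc2 : c ^ 2 ≤ r * δ' := by
    rw [hce]
    exact (sq_intervalIntegral_le hr.le hei he2i).trans (by gcongr)
  set ψ : ℝ → ℝ := fun t => χ t * g t - c * η t with hψ
  have hψs : ContDiff ℝ (⊤ : ℕ∞) ψ := (χ.contDiff.mul hg2).sub (contDiff_const.mul hηs)
  have hψ0 : ∀ t ∉ Ioo (a - ρ) (b + ρ), ψ t = 0 := fun t ht => by
    simp [hψ, hχ0 t ht, hη0 t ht]
  have hψI : ∫ t in (0 : ℝ)..r, ψ t = 0 := by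
    rw [hψ, intervalIntegral.integral_sub (Continuous.intervalIntegrable (by fun_prop) _ _)
      (Continuous.intervalIntegrable (by fun_prop) _ _), intervalIntegral.integral_const_mul, hηI]
    simp [hc]
  set φ : ℝ → ℝ := fun t => ∫ s in (0 : ℝ)..t, ψ s with hφ
  have hφd : ∀ t, HasDerivAt φ (ψ t) t := fun t =>
    (hψs.continuous.integral_hasStrictDerivAt 0 t).hasDerivAt
  have hφd' : deriv φ = ψ := funext fun t => (hφd t).deriv
  have hφs : ContDiff ℝ (⊤ : ℕ∞) φ :=
    contDiff_infty_iff_deriv.2 ⟨fun t => (hφd t).differentiableAt, hφd' ▸ hψs⟩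
  have hsupp : Function.support φ ⊆ Icc (a - ρ) (b + ρ) := by
    intro t ht
    by_contra h
    refine ht ?_
    rw [mem_Icc, not_and_or, not_le, not_le] at h
    rcases h with h | h
    · refine (intervalIntegral.integral_congr (g := fun _ => 0) fun s hs => ?_).trans (by simp)
      refine hψ0 s fun h' => ?_
      rw [mem_uIcc] at hs
      rcases hs with hs | hs <;> linarith [hs.1, hs.2, h'.1]
    · rw [← hψI]
      simp only [hφ]
      rw [intervalIntegral.integral_eq_integral_of_support_subset,
        intervalIntegral.integral_eq_integral_of_support_subset]
      all_goals
        intro s hs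
        by_contra h2
        exact hs (hψ0 s fun h' => h2 ⟨by linarith [h'.1], by linarith [h'.2]⟩)
  refine ⟨φ, hφs, .of_support_subset_isCompact isCompact_Icc hsupp,
    (closure_minimal hsupp isClosed_Icc).trans fun t ht =>
      ⟨by linarith [ht.1], by linarith [ht.2]⟩, ?_⟩
  rw [hφd']
  have h1 : ∀ t, (ψ t - d t) ^ 2 ≤ 2 * e t ^ 2 + 2 * c ^ 2 * η t ^ 2 := fun t => by
    simp only [hψ, he]
    nlinarith [sq_nonneg ((χ t * g t - d t) + c * η t)]
  have hηi : IntervalIntegrable (fun t => η t ^ 2) volume 0 r :=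
    Continuous.intervalIntegrable (by fun_prop) _ _
  calc ∫ t in (0 : ℝ)..r, (ψ t - d t) ^ 2
      ≤ ∫ t in (0 : ℝ)..r, (2 * e t ^ 2 + 2 * c ^ 2 * η t ^ 2) := by
        refine intervalIntegral.integral_mono_on hr.le ?_
          ((he2i.const_mul _).add (hηi.const_mul _)) fun t _ => h1 t
        obtain ⟨Bη, hBη⟩ := hηc.bounded_above_of_compact_support χ.hasCompactSupport_normed
        refine intervalIntegrable_of_bounded ((hψs.continuous.measurable.sub hd).pow_const 2)
          (B := 2 * (Bg + B) ^ 2 + 2 * c ^ 2 * Bη ^ 2) (fun t => ?_) 0 r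
        rw [abs_of_nonneg (sq_nonneg _)]
        refine (h1 t).trans ?_
        rw [← sq_abs (e t), ← sq_abs (η t)]
        have := heB t
        have := hBη t
        rw [Real.norm_eq_abs] at this
        gcongr
    _ = 2 * (∫ t in (0 : ℝ)..r, e t ^ 2) + 2 * c ^ 2 * J := by
        rw [intervalIntegral.integral_add (he2i.const_mul _) (hηi.const_mul _),
          intervalIntegral.integral_const_mul, intervalIntegral.integral_const_mul]
    _ ≤ 2 * δ' + 2 * (r * δ') * J := by gcongr
    _ = δ := by rw [hδ']; field_simp

lemma sq_le_add_sq_sub {s : ℝ} (hs : 0 < s) (x y : ℝ) :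
    x ^ 2 ≤ (1 + s) * y ^ 2 + (1 + 1 / s) * (x - y) ^ 2 := by
  have h : (1 + s) * y ^ 2 + (1 + 1 / s) * (x - y) ^ 2 - x ^ 2 = (s * y - (x - y)) ^ 2 / s := by
    field_simp
    ring
  have : 0 ≤ (s * y - (x - y)) ^ 2 / s := by positivity
  linarith

/-- The defining inequality of `mu` extends to Lipschitz trial functions supported in `(0, r)`. -/
lemma mu_mul_le_of_primitive {p : ℝ → ℝ} (hpc : Continuous p) (hp : ∀ t, 0 ≤ p t)
    {r a b : ℝ} (ha : 0 < a) (hab : a < b) (hb : b < r)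
    {d : ℝ → ℝ} (hd : Measurable d) {B : ℝ} (hB : ∀ t, |d t| ≤ B)
    (hd0 : ∀ t ∉ Icc a b, d t = 0) (hI : ∫ t in (0 : ℝ)..r, d t = 0) :
    mu 2 p (Ioo 0 r) * ∫ t in (0 : ℝ)..r, (∫ s in (0 : ℝ)..t, d s) ^ 2 * p t ≤
      ∫ t in (0 : ℝ)..r, d t ^ 2 * p t := by
  have hr : 0 < r := by linarith
  set κ := mu 2 p (Ioo 0 r)
  have hκ : 0 ≤ κ := mu_nonneg measurableSet_Ioo fun t _ => hp t
  set Φ : ℝ → ℝ := fun t => ∫ s in (0 : ℝ)..t, d s with hΦ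
  have hdi := intervalIntegrable_of_bounded hd hB
  have hΦc : Continuous Φ := intervalIntegral.continuous_primitive hdi 0
  obtain ⟨M, hM⟩ : ∃ M, ∀ t ∈ Icc 0 r, p t ≤ M := by
    obtain ⟨M, hM⟩ := isCompact_Icc.bddAbove_image (hpc.continuousOn (s := Icc 0 r))
    exact ⟨M, fun t ht => hM (mem_image_of_mem _ ht)⟩
  have hM0 : 0 ≤ M := (hp 0).trans (hM 0 ⟨le_rfl, hr.le⟩)
  have hd2i : IntervalIntegrable (fun t => d t ^ 2) volume 0 r := by
    refine intervalIntegrable_of_bounded (hd.pow_const 2) (B := B ^ 2) (fun t => ?_) 0 r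
    rw [abs_pow]
    exact pow_le_pow_left₀ (abs_nonneg _) (hB t) 2
  have hdpi : IntervalIntegrable (fun t => d t ^ 2 * p t) volume 0 r :=
    hd2i.mul_continuousOn hpc.continuousOn
  set D := ∫ t in (0 : ℝ)..r, d t ^ 2 * p t
  have hD : 0 ≤ D := intervalIntegral.integral_nonneg hr.le fun t _ =>
    mul_nonneg (sq_nonneg _) (hp t)
  have main : ∀ s > 0, κ * ∫ t in (0 : ℝ)..r, Φ t ^ 2 * p t ≤ (1 + s) ^ 2 * D := by
    intro s hs
    set K := (1 + s) * (1 + 1 / s) * M + κ * ((1 + 1 / s) * (r * M * r)) with hK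
    have hK0 : 0 < K + 1 := by positivity
    refine le_of_forall_pos_le_add fun ε hε => ?_
    obtain ⟨φ, h1, h2, h3, h4⟩ := exists_testFunction_deriv_near ha hab hb hd hB hd0 hI
      (δ := ε / (K + 1)) (by positivity)
    set δ := ε / (K + 1)
    have hφc := h1.continuous
    have hdφ : Continuous (deriv φ) := h1.continuous_deriv (by simp)
    have hφ0 : φ 0 = 0 := image_eq_zero_of_notMem_tsupport fun h => (h3 h).1.false
    have hφI : ∀ t, φ t = ∫ s in (0 : ℝ)..t, deriv φ s := fun t => by
      rw [intervalIntegral.integral_deriv_eq_sub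
        (fun x _ => h1.differentiable (by simp) x) (hdφ.intervalIntegrable _ _), hφ0, sub_zero]
    obtain ⟨B', hB'⟩ := hdφ.bounded_above_of_compact_support h2.deriv
    have heB : ∀ t, |deriv φ t - d t| ≤ B' + B := fun t =>
      (abs_sub _ _).trans (add_le_add (hB' t) (hB t))
    have hem : Measurable fun t => deriv φ t - d t := hdφ.measurable.sub hd
    have hei := intervalIntegrable_of_bounded hem heB
    have he2i : ∀ a b, IntervalIntegrable (fun t => (deriv φ t - d t) ^ 2) volume a b := by
      refine intervalIntegrable_of_bounded (hem.pow_const 2) (B := (B' + B) ^ 2) (fun t => ?_)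
      rw [abs_pow]
      exact pow_le_pow_left₀ (abs_nonneg _) (heB t) 2
    have hclose : ∀ t ∈ Icc 0 r, (Φ t - φ t) ^ 2 ≤ r * δ := fun t ht => by
      have h5 : Φ t - φ t = -∫ s in (0 : ℝ)..t, (deriv φ s - d s) := by
        rw [intervalIntegral.integral_sub (hdφ.intervalIntegrable _ _) (hdi _ _), hφI t]
        ring
      rw [h5, neg_sq]
      refine (sq_intervalIntegral_le ht.1 (hei _ _) (he2i _ _)).trans ?_
      refine mul_le_mul ht.2 (le_trans ?_ h4)
        (intervalIntegral.integral_nonneg ht.1 fun _ _ => sq_nonneg _) hr.le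
      exact intervalIntegral.integral_mono_interval le_rfl ht.1 ht.2
        (.of_forall fun _ => sq_nonneg _) (he2i _ _)
    have hR : κ * ∫ t in (0 : ℝ)..r, φ t ^ 2 * p t ≤ ∫ t in (0 : ℝ)..r, deriv φ t ^ 2 * p t := by
      have := mu_mul_le measurableSet_Ioo (fun t _ => hp t) h1 h2 h3
      simpa only [intervalIntegral.integral_of_le hr.le, integral_Ioc_eq_integral_Ioo] using this
    have hφp : IntervalIntegrable (fun t => φ t ^ 2 * p t) volume 0 r :=
      Continuous.intervalIntegrable (by fun_prop) _ _
    have hdφp : IntervalIntegrable (fun t => deriv φ t ^ 2 * p t) volume 0 r :=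
      Continuous.intervalIntegrable (by fun_prop) _ _
    have hA : ∫ t in (0 : ℝ)..r, Φ t ^ 2 * p t ≤
        (1 + s) * (∫ t in (0 : ℝ)..r, φ t ^ 2 * p t) + (1 + 1 / s) * (r * δ * M * r) := by
      calc _ ≤ ∫ t in (0 : ℝ)..r, ((1 + s) * (φ t ^ 2 * p t) + (1 + 1 / s) * (r * δ * M)) := by
            refine intervalIntegral.integral_mono_on hr.le
              (Continuous.intervalIntegrable (by fun_prop) _ _)
              ((hφp.const_mul _).add (by simp)) fun t ht => ?_
            have h6 := mul_le_mul_of_nonneg_right (sq_le_add_sq_sub hs (Φ t) (φ t)) (hp t)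
            have h7 : (Φ t - φ t) ^ 2 * p t ≤ r * δ * M :=
              mul_le_mul (hclose t ht) (hM t ht) (hp t) (by positivity)
            have h8 : 0 < 1 + 1 / s := by positivity
            nlinarith [mul_le_mul_of_nonneg_left h7 h8.le]
        _ = _ := by
            rw [intervalIntegral.integral_add (hφp.const_mul _) (by simp),
              intervalIntegral.integral_const_mul, intervalIntegral.integral_const]
            simp only [sub_zero, smul_eq_mul]
            ring
    have hBd : ∫ t in (0 : ℝ)..r, deriv φ t ^ 2 * p t ≤ (1 + s) * D + (1 + 1 / s) * (M * δ) := by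
      calc _ ≤ ∫ t in (0 : ℝ)..r,
            ((1 + s) * (d t ^ 2 * p t) + (1 + 1 / s) * M * (deriv φ t - d t) ^ 2) := by
            refine intervalIntegral.integral_mono_on hr.le hdφp
              ((hdpi.const_mul _).add ((he2i _ _).const_mul _)) fun t ht => ?_
            have h6 := mul_le_mul_of_nonneg_right (sq_le_add_sq_sub hs (deriv φ t) (d t)) (hp t)
            have h7 := mul_le_mul_of_nonneg_left (hM t ht) (sq_nonneg (deriv φ t - d t))
            have h8 : 0 < 1 + 1 / s := by positivity
            nlinarith [mul_le_mul_of_nonneg_left h7 h8.le]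
        _ = (1 + s) * D + (1 + 1 / s) * M * ∫ t in (0 : ℝ)..r, (deriv φ t - d t) ^ 2 := by
            rw [intervalIntegral.integral_add (hdpi.const_mul _) ((he2i _ _).const_mul _),
              intervalIntegral.integral_const_mul, intervalIntegral.integral_const_mul]
        _ ≤ (1 + s) * D + (1 + 1 / s) * M * δ := by gcongr
        _ = _ := by ring
    have hKδ : K * δ ≤ ε := by
      have : (K + 1) * δ = ε := mul_div_cancel₀ _ hK0.ne'
      have : 0 < δ := by positivity
      linarith
    calc _ ≤ κ * ((1 + s) * (∫ t in (0 : ℝ)..r, φ t ^ 2 * p t) +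
            (1 + 1 / s) * (r * δ * M * r)) := by gcongr
      _ = (1 + s) * (κ * ∫ t in (0 : ℝ)..r, φ t ^ 2 * p t) +
            κ * ((1 + 1 / s) * (r * δ * M * r)) := by ring
      _ ≤ (1 + s) * ((1 + s) * D + (1 + 1 / s) * (M * δ)) +
            κ * ((1 + 1 / s) * (r * δ * M * r)) := by
          have := hR.trans hBd
          gcongr
      _ = (1 + s) ^ 2 * D + K * δ := by rw [hK]; ring
      _ ≤ _ := by gcongr
  have hlim : Tendsto (fun s : ℝ => (1 + s) ^ 2 * D) (𝓝[>] 0) (𝓝 D) := by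
    have : Continuous fun s : ℝ => (1 + s) ^ 2 * D := by fun_prop
    simpa using (this.tendsto 0).mono_left nhdsWithin_le_nhds
  exact ge_of_tendsto hlim (eventually_mem_nhdsWithin.mono fun s hs => main s hs)

end TrialFunctions

namespace ConicalWeight

variable {p u : ℝ → ℝ} {C r κ : ℝ}

lemma mass_pos (hp : ConicalWeight p C) (hu : Continuous u) {t : ℝ} (ht : 0 < t)
    (h : ∀ s ∈ Ioo 0 t, 0 < u s) : 0 < ∫ s in (0 : ℝ)..t, p s * u s := by
  refine intervalIntegral.intervalIntegral_pos_of_pos_on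
    ((hp.continuous.mul hu).intervalIntegrable _ _) (fun s hs => ?_) ht
  exact mul_pos (hp.pos s hs.1) (h s hs)

/-- A radial solution that stays positive up to the boundary has subcritical eigenvalue. -/
lemma lt_mu_of_pos (hp : ConicalWeight p C) (hr : 0 < r) (hu : Continuous u)
    (hu' : ∀ t ∈ Ioo 0 r, HasDerivAt u (-κ * average p u t) t) (hpos : ∀ t ∈ Icc 0 r, 0 < u t) :
    κ < mu 2 p (Ioo 0 r) := by
  set A : ℝ → ℝ := fun t => average p (fun s => u s ^ 2) t / u t ^ 2 with hA
  have hu2 : Continuous fun s => u s ^ 2 := by fun_prop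
  have hAc : ContinuousOn A (Icc 0 r) :=
    (hp.continuous_average hu2).continuousOn.div hu2.continuousOn
      fun t ht => (pow_pos (hpos t ht) 2).ne'
  obtain ⟨K, hK⟩ := isCompact_Icc.exists_bound_of_continuousOn hAc
  set δ : ℝ := 1 / (2 * (K ^ 2 + 1)) with hδ
  have hδ0 : 0 < δ := by positivity
  have hδK : δ * K ^ 2 ≤ 1 / 2 := by
    rw [hδ, div_mul_eq_mul_div, div_le_div_iff₀ (by positivity) (by positivity)]
    linarith
  set P : ℝ → ℝ := fun t => ∫ s in (0 : ℝ)..t, p s * u s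
  set W : ℝ → ℝ := fun t => ∫ s in (0 : ℝ)..t, p s * u s ^ 2
  have hP : ∀ t, HasDerivAt P (p t * u t) t := hp.hasDerivAt_mass hu
  have hW : ∀ t, HasDerivAt W (p t * u t ^ 2) t := hp.hasDerivAt_mass hu2
  have hN := hp.continuous_average hu
  have hpc := hp.continuous
  have hPc : Continuous P := continuous_iff_continuousAt.2 fun t => (hP t).continuousAt
  have hWc : Continuous W := continuous_iff_continuousAt.2 fun t => (hW t).continuousAt
  have hne : ∀ t ∈ Ioo 0 r, u t ≠ 0 := fun t ht => (hpos t (Ioo_subset_Icc_self ht)).ne'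
  refine lt_of_lt_of_le (b := κ + δ / 2) (by linarith) (le_mu_of_flux
    (V := fun t => κ * (P t / u t) + δ * (W t / u t ^ 2))
    (V' := fun t => κ * ((p t * u t * u t - P t * (-κ * average p u t)) / u t ^ 2) +
      δ * ((p t * u t ^ 2 * u t ^ 2 - W t * (2 * u t * (-κ * average p u t))) / (u t ^ 2) ^ 2))
    isOpen_Ioo (nonempty_Ioo.2 hr) hpc (fun t ht => hp.pos t ht.1) (fun t ht => ?_) ?_
    fun t ht => ?_)
  · have h2 : HasDerivAt (fun t => u t ^ 2) (2 * u t * (-κ * average p u t)) t := by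
      simpa using (hu' t ht).fun_pow 2
    exact (((hP t).div (hu' t ht) (hne t ht)).const_mul κ).add
      (((hW t).div h2 (pow_ne_zero 2 (hne t ht))).const_mul δ)
  · refine ContinuousOn.add (continuousOn_const.mul (ContinuousOn.div ?_ ?_ ?_))
      (continuousOn_const.mul (ContinuousOn.div ?_ ?_ ?_))
    · fun_prop
    · fun_prop
    · exact fun t ht => pow_ne_zero 2 (hne t ht)
    · fun_prop
    · fun_prop
    · exact fun t ht => pow_ne_zero 2 (pow_ne_zero 2 (hne t ht))
  · have hpt := hp.pos t ht.1
    have h1 : P t = p t * average p u t := (hp.mul_average u ht.1.le).symm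
    have h2 : W t = p t * (A t * u t ^ 2) := by
      rw [hA]
      simp only
      rw [div_mul_cancel₀ _ (pow_ne_zero 2 (hne t ht)), hp.mul_average _ ht.1.le]
    have h3 := hne t ht
    rw [h1, h2]
    have hAK := abs_le.1 (hK t (Ioo_subset_Icc_self ht))
    have h4 : A t ^ 2 ≤ K ^ 2 := sq_le_sq' (by linarith) hAK.2
    have h5 : κ * ((p t * u t * u t - p t * average p u t * (-κ * average p u t)) / u t ^ 2) +
        δ * ((p t * u t ^ 2 * u t ^ 2 - p t * (A t * u t ^ 2) * (2 * u t * (-κ * average p u t))) /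
          (u t ^ 2) ^ 2) -
        (κ * (p t * average p u t / u t) + δ * (p t * (A t * u t ^ 2) / u t ^ 2)) ^ 2 / p t =
        p t * (κ + δ - δ * (δ * A t ^ 2)) := by
      field_simp
      ring
    rw [h5, mul_comm]
    refine mul_le_mul_of_nonneg_left ?_ hpt.le
    have h6 : δ * A t ^ 2 ≤ 1 / 2 := (mul_le_mul_of_nonneg_left h4 hδ0.le).trans hδK
    have h7 := mul_le_mul_of_nonneg_left h6 hδ0.le
    linarith

lemma mu_pos (hp : ConicalWeight p C) (hr : 0 < r) : 0 < mu 2 p (Ioo 0 r) := by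
  refine hp.lt_mu_of_pos (u := fun _ => 1) hr continuous_const (fun t _ => ?_) (by simp)
  simpa using hasDerivAt_const t (1 : ℝ)

lemma intervalIntegral_congr_Ioc {f g : ℝ → ℝ} {a b : ℝ} (hab : a ≤ b)
    (h : ∀ t ∈ Ioc a b, f t = g t) : ∫ t in a..b, f t = ∫ t in a..b, g t := by
  rw [intervalIntegral.integral_of_le hab, intervalIntegral.integral_of_le hab]
  exact setIntegral_congr_fun measurableSet_Ioc h

/-- Testing with a radial solution cut off logarithmically below `ε` and linearly above `t₁`. -/
lemma mu_mul_mass_le (hp : ConicalWeight p C) (hu : Continuous u)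
    (hu' : ∀ t ∈ Ioo 0 r, HasDerivAt u (-mu 2 p (Ioo 0 r) * average p u t) t)
    {M : ℝ} (hM : ∀ t ∈ Icc 0 r, p t ≤ M) {ε t₁ b L : ℝ} (hε : 0 < ε) (hεt : ε < t₁)
    (htb : t₁ < b) (hb : b < r) (hL : 0 < L) :
    mu 2 p (Ioo 0 r) * (u t₁ * ∫ s in (0 : ℝ)..t₁, p s * u s) ≤
      C * u ε ^ 2 / L + mu 2 p (Ioo 0 r) * (u ε * ∫ s in (0 : ℝ)..ε, p s * u s) +
        u t₁ ^ 2 * M / (b - t₁) := by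
  set κ := mu 2 p (Ioo 0 r)
  set N := average p u
  have hNc : Continuous N := hp.continuous_average hu
  have hpc := hp.continuous
  set P : ℝ → ℝ := fun t => ∫ s in (0 : ℝ)..t, p s * u s with hPdef
  have hP : ∀ t, HasDerivAt P (p t * u t) t := hp.hasDerivAt_mass hu
  set a := ε * Real.exp (-L) with ha
  have ha0 : 0 < a := by positivity
  have haε : a < ε := by
    have : Real.exp (-L) < 1 := (Real.exp_lt_exp.2 (by linarith : -L < 0)).trans_eq Real.exp_zero
    nlinarith
  have hlog : Real.log (ε / a) = L := by
    rw [ha, Real.exp_neg]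
    field_simp
    exact Real.log_exp L
  have hr : 0 < r := by linarith
  have hbt : 0 < b - t₁ := by linarith
  set d : ℝ → ℝ := fun t => if t ≤ a then 0 else if t ≤ ε then u ε / L * t⁻¹ else
    if t ≤ t₁ then -κ * N t else if t ≤ b then -(u t₁ / (b - t₁)) else 0 with hd
  have hdm : Measurable d := by
    refine Measurable.ite measurableSet_Iic measurable_const ?_
    refine Measurable.ite measurableSet_Iic (measurable_inv.const_mul _) ?_
    refine Measurable.ite measurableSet_Iic (hNc.measurable.const_mul _) ?_
    exact Measurable.ite measurableSet_Iic measurable_const measurable_const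
  obtain ⟨K, hK⟩ := isCompact_Icc.exists_bound_of_continuousOn (hNc.continuousOn (s := Icc 0 r))
  have hK0 : 0 ≤ K := (norm_nonneg _).trans (hK 0 ⟨le_rfl, hr.le⟩)
  have hdB : ∀ t, |d t| ≤ |u ε / L| * a⁻¹ + |κ| * K + |u t₁ / (b - t₁)| := by
    intro t
    have e1 : 0 ≤ |u ε / L| * a⁻¹ := by positivity
    have e2 : 0 ≤ |κ| * K := by positivity
    have e3 : 0 ≤ |u t₁ / (b - t₁)| := abs_nonneg _
    simp only [hd]
    split_ifs with h1 h2 h3 h4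
    · simp only [abs_zero]; positivity
    · rw [abs_mul, abs_of_pos (inv_pos.2 (ha0.trans (not_le.1 h1)))]
      have : t⁻¹ ≤ a⁻¹ := inv_anti₀ ha0 (not_le.1 h1).le
      have := mul_le_mul_of_nonneg_left this (abs_nonneg (u ε / L))
      linarith
    · rw [abs_mul, abs_neg]
      have := mul_le_mul_of_nonneg_left (hK t ⟨by linarith, by linarith⟩) (abs_nonneg κ)
      rw [Real.norm_eq_abs] at this
      linarith
    · rw [abs_neg]
      linarith
    · simp only [abs_zero]; positivity
  have hd0 : ∀ t ∉ Icc a b, d t = 0 := by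
    intro t ht
    simp only [hd]
    split_ifs with h1 h2 h3 h4
    · rfl
    all_goals first
      | rfl
      | exact absurd ⟨by linarith, by linarith⟩ ht
  have hdi := intervalIntegrable_of_bounded hdm hdB
  have hd2i : ∀ x y, IntervalIntegrable (fun t => d t ^ 2 * p t) volume x y := fun x y => by
    refine (intervalIntegrable_of_bounded (hdm.pow_const 2)
      (B := (|u ε / L| * a⁻¹ + |κ| * K + |u t₁ / (b - t₁)|) ^ 2) (fun t => ?_) x y).mul_continuousOn
      hpc.continuousOn
    rw [abs_pow]
    exact pow_le_pow_left₀ (abs_nonneg _) (hdB t) 2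
  -- values of `d` on the pieces
  have v1 : ∀ t ∈ Ioc 0 a, d t = 0 := fun t ht => by simp [hd, ht.2]
  have v2 : ∀ t ∈ Ioc a ε, d t = u ε / L * t⁻¹ := fun t ht => by
    simp [hd, ht.2, not_le.2 ht.1]
  have v3 : ∀ t ∈ Ioc ε t₁, d t = -κ * N t := fun t ht => by
    simp [hd, ht.2, not_le.2 ht.1, not_le.2 (haε.trans ht.1)]
  have v4 : ∀ t ∈ Ioc t₁ b, d t = -(u t₁ / (b - t₁)) := fun t ht => by
    simp [hd, ht.2, not_le.2 ht.1, not_le.2 (hεt.trans ht.1), not_le.2 ((haε.trans hεt).trans ht.1)]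
  have v5 : ∀ t ∈ Ioc b r, d t = 0 := fun t ht => hd0 t fun h => h.2.not_gt ht.1
  have i1 : ∫ t in (0 : ℝ)..a, d t = 0 := by
    rw [intervalIntegral_congr_Ioc ha0.le v1]; simp
  have i2 : ∫ t in a..ε, d t = u ε := by
    rw [intervalIntegral_congr_Ioc haε.le v2, intervalIntegral.integral_const_mul,
      integral_inv_of_pos ha0 hε, hlog]
    field_simp
  have i3 : ∀ t ∈ Icc ε t₁, ∫ s in ε..t, d s = u t - u ε := fun t ht => by
    rw [intervalIntegral_congr_Ioc ht.1 fun s hs => v3 s ⟨hs.1, hs.2.trans ht.2⟩]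
    refine intervalIntegral.integral_eq_sub_of_hasDerivAt (fun s hs => ?_)
      (Continuous.intervalIntegrable (by fun_prop) _ _)
    rw [uIcc_of_le ht.1] at hs
    exact hu' s ⟨by linarith [hs.1], by linarith [hs.2, ht.2]⟩
  have i4 : ∫ t in t₁..b, d t = -u t₁ := by
    rw [intervalIntegral_congr_Ioc htb.le v4, intervalIntegral.integral_const, smul_eq_mul]
    field_simp
  have i5 : ∫ t in b..r, d t = 0 := by
    rw [intervalIntegral_congr_Ioc hb.le v5]; simp
  have hΦ : ∀ t ∈ Icc ε t₁, ∫ s in (0 : ℝ)..t, d s = u t := fun t ht => by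
    rw [← intervalIntegral.integral_add_adjacent_intervals (hdi 0 ε) (hdi ε t),
      ← intervalIntegral.integral_add_adjacent_intervals (hdi 0 a) (hdi a ε), i1, i2, i3 t ht]
    ring
  have hI : ∫ t in (0 : ℝ)..r, d t = 0 := by
    rw [← intervalIntegral.integral_add_adjacent_intervals (hdi 0 t₁) (hdi t₁ r),
      ← intervalIntegral.integral_add_adjacent_intervals (hdi t₁ b) (hdi b r),
      hΦ t₁ ⟨hεt.le, le_rfl⟩, i4, i5]
    ring
  have hR := mu_mul_le_of_primitive hpc hp.nonneg ha0 (haε.trans (hεt.trans htb)) hb hdm hdB hd0 hI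
  have hκ : 0 ≤ κ := (hp.mu_pos hr).le
  -- lower bound of the left-hand side
  have hlow : ∫ t in ε..t₁, u t ^ 2 * p t ≤
      ∫ t in (0 : ℝ)..r, (∫ s in (0 : ℝ)..t, d s) ^ 2 * p t := by
    have hΦc : Continuous fun t => ∫ s in (0 : ℝ)..t, d s :=
      intervalIntegral.continuous_primitive hdi 0
    rw [← intervalIntegral_congr_Ioc (f := fun t => (∫ s in (0 : ℝ)..t, d s) ^ 2 * p t) hεt.le
      fun t ht => by rw [hΦ t (Ioc_subset_Icc_self ht)]]
    exact intervalIntegral.integral_mono_interval hε.le hεt.le (by linarith)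
      (.of_forall fun t => mul_nonneg (sq_nonneg _) (hp.nonneg t))
      (Continuous.intervalIntegrable (by fun_prop) _ _)
  -- the energy on the pieces
  have j1 : ∫ t in (0 : ℝ)..a, d t ^ 2 * p t = 0 := by
    rw [intervalIntegral_congr_Ioc (g := fun _ => 0) ha0.le fun t ht => by simp [v1 t ht]]; simp
  have j2 : ∫ t in a..ε, d t ^ 2 * p t ≤ C * u ε ^ 2 / L := by
    have hinv : IntervalIntegrable (fun t : ℝ => t⁻¹) volume a ε :=
      intervalIntegral.intervalIntegrable_inv (fun t ht => by
        rw [uIcc_of_le haε.le] at ht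
        linarith [ht.1]) continuousOn_id
    calc _ ≤ ∫ t in a..ε, C * (u ε / L) ^ 2 * t⁻¹ := by
          refine intervalIntegral.integral_mono_on_of_le_Ioo haε.le (hd2i _ _)
            (hinv.const_mul _) fun t ht => ?_
          have ht0 : 0 < t := ha0.trans ht.1
          rw [v2 t ⟨ht.1, ht.2.le⟩]
          have := mul_le_mul_of_nonneg_left (hp.le_linear t ht0.le)
            (sq_nonneg (u ε / L * t⁻¹))
          refine this.trans (le_of_eq ?_)
          field_simp
      _ = _ := by
          rw [intervalIntegral.integral_const_mul, integral_inv_of_pos ha0 hε, hlog]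
          field_simp
  have j3 : ∫ t in ε..t₁, d t ^ 2 * p t =
      κ * ((∫ t in ε..t₁, u t ^ 2 * p t) - (u t₁ * P t₁ - u ε * P ε)) := by
    have h1 : ∫ t in ε..t₁, (u t ^ 2 * p t - κ * (N t ^ 2 * p t)) = u t₁ * P t₁ - u ε * P ε := by
      refine intervalIntegral.integral_eq_sub_of_hasDerivAt (f := fun t => u t * P t)
        (fun s hs => ?_) (Continuous.intervalIntegrable (by fun_prop) _ _)
      rw [uIcc_of_le hεt.le] at hs
      have hs0 : 0 < s := by linarith [hs.1]
      convert! (hu' s ⟨hs0, by linarith [hs.2]⟩).mul (hP s) using 1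
      have : P s = p s * N s := (hp.mul_average u hs0.le).symm
      rw [this]
      ring
    rw [← h1, ← intervalIntegral.integral_sub (Continuous.intervalIntegrable (by fun_prop) _ _)
      (Continuous.intervalIntegrable (by fun_prop) _ _), ← intervalIntegral.integral_const_mul]
    refine intervalIntegral_congr_Ioc hεt.le fun t ht => ?_
    rw [v3 t ht]
    ring
  have j4 : ∫ t in t₁..b, d t ^ 2 * p t ≤ u t₁ ^ 2 * M / (b - t₁) := by
    calc _ ≤ ∫ t in t₁..b, (u t₁ / (b - t₁)) ^ 2 * M := by
          refine intervalIntegral.integral_mono_on_of_le_Ioo htb.le (hd2i _ _) (by simp)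
            fun t ht => ?_
          rw [v4 t ⟨ht.1, ht.2.le⟩, neg_sq]
          exact mul_le_mul_of_nonneg_left
            (hM t ⟨by linarith [ht.1], by linarith [ht.2]⟩) (sq_nonneg _)
      _ = _ := by
          rw [intervalIntegral.integral_const, smul_eq_mul]
          field_simp
  have j5 : ∫ t in b..r, d t ^ 2 * p t = 0 := by
    rw [intervalIntegral_congr_Ioc (g := fun _ => 0) hb.le fun t ht => by simp [v5 t ht]]; simp
  rw [← intervalIntegral.integral_add_adjacent_intervals (hd2i 0 t₁) (hd2i t₁ r),
    ← intervalIntegral.integral_add_adjacent_intervals (hd2i t₁ b) (hd2i b r),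
    ← intervalIntegral.integral_add_adjacent_intervals (hd2i 0 ε) (hd2i ε t₁),
    ← intervalIntegral.integral_add_adjacent_intervals (hd2i 0 a) (hd2i a ε), j1, j3, j5] at hR
  have := mul_le_mul_of_nonneg_left hlow hκ
  linarith

/-- The radial solution at the fundamental tone is positive inside `(0, r)`. -/
lemma radial_solution_pos (hp : ConicalWeight p C) (hu : Continuous u) (hu0 : u 0 = 1)
    (hu' : ∀ t ∈ Ioo 0 r, HasDerivAt u (-mu 2 p (Ioo 0 r) * average p u t) t) :
    ∀ t ∈ Ico 0 r, 0 < u t := by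
  by_contra! hcon
  obtain ⟨x, hx, hux⟩ := hcon
  have hr : 0 < r := hx.1.trans_lt hx.2
  obtain ⟨r₀, ⟨hr₀, hur₀⟩, hmin⟩ :=
    (isCompact_Icc.inter_right (isClosed_Iic.preimage hu)).exists_isLeast
      (s := Icc 0 x ∩ u ⁻¹' Iic 0) ⟨x, ⟨hx.1, le_rfl⟩, hux⟩
  rw [mem_preimage, mem_Iic] at hur₀
  have hr₀0 : 0 < r₀ := by
    refine hr₀.1.lt_of_ne fun h => ?_
    rw [← h, hu0] at hur₀
    linarith
  have hr₀r : r₀ < r := hr₀.2.trans_lt hx.2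
  have hpos : ∀ t ∈ Ico 0 r₀, 0 < u t := fun t ht => by
    by_contra! h
    exact (hmin ⟨⟨ht.1, ht.2.le.trans hr₀.2⟩, h⟩).not_gt ht.2
  set κ := mu 2 p (Ioo 0 r)
  have hκ : 0 < κ := hp.mu_pos hr
  obtain ⟨M, hM⟩ : ∃ M, ∀ t ∈ Icc 0 r, p t ≤ M := by
    obtain ⟨M, hM⟩ := isCompact_Icc.bddAbove_image (hp.continuous.continuousOn (s := Icc 0 r))
    exact ⟨M, fun t ht => hM (mem_image_of_mem _ ht)⟩
  have hM0 : 0 ≤ M := (hp.nonneg 0).trans (hM 0 ⟨le_rfl, hr.le⟩)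
  set b := (r₀ + r) / 2
  have hb1 : r₀ < b := by simp only [b]; linarith
  have hb2 : b < r := by simp only [b]; linarith
  set P : ℝ → ℝ := fun t => ∫ s in (0 : ℝ)..t, p s * u s with hP
  have hPc : Continuous P := continuous_iff_continuousAt.2 fun t =>
    (hp.hasDerivAt_mass hu t).continuousAt
  have key : ∀ t ∈ Ioo 0 r₀, κ * P t ≤ u t * M / (b - t) := fun t ht => by
    have h1 : κ * (u t * P t) ≤ u t ^ 2 * M / (b - t) := by
      have hlim : Tendsto (fun ε => C * u ε ^ 2 / ε⁻¹ + κ * (u ε * P ε) + u t ^ 2 * M / (b - t))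
          (𝓝[>] 0) (𝓝 (u t ^ 2 * M / (b - t))) := by
        have hc : Continuous fun ε =>
            C * u ε ^ 2 * ε + κ * (u ε * P ε) + u t ^ 2 * M / (b - t) := by
          fun_prop
        have := (hc.tendsto 0).mono_left (nhdsWithin_le_nhds (s := Ioi 0))
        simpa [hP, div_inv_eq_mul] using this
      refine ge_of_tendsto hlim ?_
      filter_upwards [Ioo_mem_nhdsGT ht.1] with ε hε
      exact hp.mu_mul_mass_le hu hu' hM hε.1 hε.2 (ht.2.trans hb1) hb2 (inv_pos.2 hε.1)
    have hut := hpos t ⟨ht.1.le, ht.2⟩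
    refine le_of_mul_le_mul_left ?_ hut
    calc _ = κ * (u t * P t) := by ring
      _ ≤ _ := h1
      _ = _ := by ring
  have hlim2 : κ * P r₀ ≤ u r₀ * M / (b - r₀) := by
    have hc1 : Tendsto (fun t => κ * P t) (𝓝[<] r₀) (𝓝 (κ * P r₀)) :=
      ((continuous_const.mul hPc).tendsto r₀).mono_left nhdsWithin_le_nhds
    have hc2 : Tendsto (fun t => u t * M / (b - t)) (𝓝[<] r₀) (𝓝 (u r₀ * M / (b - r₀))) := by
      have : ContinuousAt (fun t => u t * M / (b - t)) r₀ :=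
        (hu.continuousAt.mul continuousAt_const).div
          (continuousAt_const.sub continuousAt_id) (sub_pos.2 hb1).ne'
      exact this.tendsto.mono_left nhdsWithin_le_nhds
    refine le_of_tendsto_of_tendsto hc1 hc2 ?_
    filter_upwards [Ioo_mem_nhdsLT hr₀0] with t ht using key t ht
  have hPpos : 0 < P r₀ := hp.mass_pos hu hr₀0 fun s hs => hpos s ⟨hs.1.le, hs.2⟩
  have : u r₀ * M / (b - r₀) ≤ 0 :=
    div_nonpos_of_nonpos_of_nonneg (mul_nonpos_of_nonpos_of_nonneg hur₀ hM0) (by linarith)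
  have := mul_pos hκ hPpos
  linarith

lemma radial_solution_eq_zero (hp : ConicalWeight p C) (hr : 0 < r) (hu : Continuous u)
    (hu0 : u 0 = 1)
    (hu' : ∀ t ∈ Ioo 0 r, HasDerivAt u (-mu 2 p (Ioo 0 r) * average p u t) t) : u r = 0 := by
  have hpos := hp.radial_solution_pos hu hu0 hu'
  have h0 : 0 ≤ u r := by
    refine ge_of_tendsto ((hu.tendsto r).mono_left (nhdsWithin_le_nhds (s := Iio r))) ?_
    filter_upwards [Ioo_mem_nhdsLT hr] with t ht using (hpos t ⟨ht.1.le, ht.2⟩).le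
  by_contra hne
  refine (hp.lt_mu_of_pos hr hu hu' fun t ht => ?_).false
  rcases ht.2.eq_or_lt with rfl | h
  · exact h0.lt_of_ne' hne
  · exact hpos t ⟨ht.1, h⟩

/-- Rigidity: if `p / q` is nondecreasing and both weights have the same fundamental tone, then
`p / q` has vanishing derivative. -/
lemma deriv_ratio_eq_zero {q : ℝ → ℝ} {C' : ℝ} (hp : ConicalWeight p C) (hq : ConicalWeight q C')
    (hr : 0 < r) (heq : mu 2 p (Ioo 0 r) = mu 2 q (Ioo 0 r)) {h' : ℝ → ℝ}
    (hh : ∀ t ∈ Ioo 0 r, HasDerivAt (fun t => p t / q t) (h' t) t)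
    (hh' : ∀ t ∈ Ioo 0 r, 0 ≤ h' t) : ∀ t ∈ Ioo 0 r, h' t = 0 := by
  set κ := mu 2 p (Ioo 0 r) with hκ
  obtain ⟨w, hw, hw0, hw'⟩ := hp.exists_radial_solution hr κ
  obtain ⟨u, hu, hu0, hu'⟩ := hq.exists_radial_solution hr κ
  have hwpos := hp.radial_solution_pos hw hw0 hw'
  have hwr := hp.radial_solution_eq_zero hr hw hw0 hw'
  have hupos := hq.radial_solution_pos hu hu0 (heq ▸ hu')
  have hur := hq.radial_solution_eq_zero hr hu hu0 (heq ▸ hu')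
  have hpc := hp.continuous
  have hNp := hp.continuous_average hw
  have hNq := hq.continuous_average hu
  set Z : ℝ → ℝ := fun t => p t * (u t * average p w t - w t * average q u t) with hZ
  have hZc : Continuous Z := by fun_prop
  have hZ' : ∀ t ∈ Ioo 0 r,
      HasDerivAt Z (-(h' t * (w t * ∫ s in (0 : ℝ)..t, q s * u s))) t := fun t ht => by
    have hd := ((hu' t ht).mul (hp.hasDerivAt_mass hw t)).sub
      ((hh t ht).mul ((hw' t ht).mul (hq.hasDerivAt_mass hu t)))
    have hqt := (hq.pos t ht.1).ne'
    refine (hd.congr_of_eventuallyEq ?_).congr_deriv ?_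
    · filter_upwards [Ioi_mem_nhds ht.1] with s hs
      have hs0 : 0 < s := hs
      have hqs := (hq.pos s hs0).ne'
      simp only [Pi.sub_apply, Pi.mul_apply, hZ]
      rw [← hp.mul_average w hs0.le, ← hq.mul_average u hs0.le]
      field_simp
    · simp only [Pi.mul_apply]
      rw [← hp.mul_average w ht.1.le, ← hq.mul_average u ht.1.le]
      field_simp
      ring
  have hQ : ∀ t ∈ Ioo 0 r, 0 < w t * ∫ s in (0 : ℝ)..t, q s * u s := fun t ht =>
    mul_pos (hwpos t ⟨ht.1.le, ht.2⟩) (hq.mass_pos hu ht.1 fun s hs =>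
      hupos s ⟨hs.1.le, hs.2.trans ht.2⟩)
  have hanti : AntitoneOn Z (Icc 0 r) := by
    refine antitoneOn_of_deriv_nonpos (convex_Icc 0 r) hZc.continuousOn ?_ ?_
    · rw [interior_Icc]
      exact fun t ht => (hZ' t ht).differentiableAt.differentiableWithinAt
    · rw [interior_Icc]
      intro t ht
      rw [(hZ' t ht).deriv, neg_nonpos]
      exact mul_nonneg (hh' t ht) (hQ t ht).le
  have hZ0 : Z 0 = 0 := by simp [hZ, hp.eq_zero]
  have hZr : Z r = 0 := by simp [hZ, hwr, hur]
  have hZz : ∀ t ∈ Ioo 0 r, Z t = 0 := fun t ht => le_antisymm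
    (hZ0 ▸ hanti ⟨le_rfl, hr.le⟩ (Ioo_subset_Icc_self ht) ht.1.le)
    (hZr ▸ hanti (Ioo_subset_Icc_self ht) ⟨hr.le, le_rfl⟩ ht.2.le)
  intro t ht
  have h0 : HasDerivAt Z 0 t := (hasDerivAt_const t (0 : ℝ)).congr_of_eventuallyEq (by
    filter_upwards [isOpen_Ioo.mem_nhds ht] with s hs using hZz s hs)
  have := (hZ' t ht).unique h0
  rw [neg_eq_zero, mul_eq_zero] at this
  exact this.resolve_right (hQ t ht).ne'

end ConicalWeight

section WarpingFunction

variable {f g : ℝ → ℝ} {r : ℝ}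

lemma tendsto_div_self_of_hasDerivWithinAt (hr : 0 < r) (hf0 : f 0 = 0)
    (hf' : HasDerivWithinAt f 1 (Icc 0 r) 0) :
    Tendsto (fun t => f t / t) (𝓝[>] 0) (𝓝 1) := by
  have h := hasDerivWithinAt_iff_tendsto_slope.1 hf'
  have h0 : slope f 0 = fun t => f t / t := by
    ext t
    simp [slope_def_field, hf0]
  rwa [h0, Icc_sdiff_left, nhdsWithin_Ioc_eq_nhdsGT hr] at h

lemma exists_linear_bounds (hr : 0 < r) (hf : ContinuousOn f (Icc 0 r)) (hf0 : f 0 = 0)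
    (hf' : HasDerivWithinAt f 1 (Icc 0 r) 0) (hpos : ∀ t ∈ Ioc 0 r, 0 < f t) :
    ∃ c K : ℝ, 0 < c ∧ 0 < K ∧ ∀ t ∈ Icc 0 r, c * t ≤ f t ∧ f t ≤ K * t := by
  set F : ℝ → ℝ := Function.update (fun t => f t / t) 0 1 with hF
  have hFt (t : ℝ) (ht : t ≠ 0) : F t = f t / t := Function.update_of_ne ht _ _
  have hF0 : F 0 = 1 := Function.update_self _ _ _
  have hFc : ContinuousOn F (Icc 0 r) := by
    intro t ht
    rcases eq_or_lt_of_le ht.1 with rfl | h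
    · rw [hF, continuousWithinAt_update_same, Icc_sdiff_left, nhdsWithin_Ioc_eq_nhdsGT hr]
      exact tendsto_div_self_of_hasDerivWithinAt hr hf0 hf'
    · rw [hF, continuousWithinAt_update_of_ne h.ne']
      exact (hf t ht).div continuousWithinAt_id h.ne'
  have hFpos : ∀ t ∈ Icc 0 r, 0 < F t := by
    intro t ht
    rcases eq_or_lt_of_le ht.1 with rfl | h
    · rw [hF0]; exact one_pos
    · rw [hFt t h.ne']; exact div_pos (hpos t ⟨h, ht.2⟩) h
  have hne : (Icc 0 r).Nonempty := nonempty_Icc.2 hr.le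
  obtain ⟨a, ha, hamin⟩ := isCompact_Icc.exists_isMinOn hne hFc
  obtain ⟨b, hb, hbmax⟩ := isCompact_Icc.exists_isMaxOn hne hFc
  refine ⟨F a, F b, hFpos a ha, hFpos b hb, fun t ht => ?_⟩
  rcases eq_or_lt_of_le ht.1 with rfl | h
  · simp [hf0]
  · have h₁ := isMinOn_iff.1 hamin t ht
    have h₂ := isMaxOn_iff.1 hbmax t ht
    rw [hFt t h.ne'] at h₁ h₂
    exact ⟨(le_div_iff₀ h).1 h₁, (div_le_iff₀ h).1 h₂⟩

lemma exists_conicalWeight (hr : 0 < r) (hf : ContinuousOn f (Icc 0 r)) (hf0 : f 0 = 0)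
    (hf' : HasDerivWithinAt f 1 (Icc 0 r) 0) (hpos : ∀ t ∈ Ioc 0 r, 0 < f t) {n : ℕ}
    (hn : 2 ≤ n) : ∃ C, ConicalWeight (fun t => f (max 0 (min r t)) ^ (n - 1)) C := by
  obtain ⟨c, K, hc, hK, hcK⟩ := exists_linear_bounds hr hf hf0 hf' hpos
  have hmem (t : ℝ) : max 0 (min r t) ∈ Icc 0 r :=
    ⟨le_max_left _ _, max_le hr.le (min_le_left _ _)⟩
  have hnn (t : ℝ) : 0 ≤ f (max 0 (min r t)) :=
    (mul_nonneg hc.le (hmem t).1).trans (hcK _ (hmem t)).1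
  have hmono {s t : ℝ} (h : s ≤ t) : max 0 (min r s) ≤ max 0 (min r t) :=
    max_le_max le_rfl (min_le_min le_rfl h)
  refine ⟨max ((K / c) ^ (n - 1)) (K ^ (n - 1) * r ^ (n - 2)), ?_, ?_, ?_, ?_, ?_⟩
  · exact (hf.comp_continuous (by fun_prop) hmem).pow _
  · exact fun t ht => pow_pos (hpos _ ⟨lt_max_of_lt_right (lt_min hr ht), (hmem t).2⟩) _
  · intro t ht
    rw [min_eq_right (ht.trans hr.le), max_eq_left ht, hf0, zero_pow (by omega)]
  · intro s t _ hst
    have h : f (max 0 (min r s)) ≤ K / c * f (max 0 (min r t)) :=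
      calc f (max 0 (min r s)) ≤ K * max 0 (min r s) := (hcK _ (hmem s)).2
        _ ≤ K * max 0 (min r t) := mul_le_mul_of_nonneg_left (hmono hst) hK.le
        _ = K / c * (c * max 0 (min r t)) := by field_simp
        _ ≤ K / c * f (max 0 (min r t)) :=
          mul_le_mul_of_nonneg_left (hcK _ (hmem t)).1 (by positivity)
    calc f (max 0 (min r s)) ^ (n - 1) ≤ (K / c * f (max 0 (min r t))) ^ (n - 1) :=
          pow_le_pow_left₀ (hnn s) h _
      _ = (K / c) ^ (n - 1) * f (max 0 (min r t)) ^ (n - 1) := mul_pow _ _ _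
      _ ≤ _ := mul_le_mul_of_nonneg_right (le_max_left _ _) (pow_nonneg (hnn t) _)
  · intro t ht
    have hx := hmem t
    have hxt : max 0 (min r t) ≤ t := max_le ht (min_le_right _ _)
    set x := max 0 (min r t)
    obtain ⟨k, rfl⟩ : ∃ k, n = k + 2 := ⟨n - 2, by omega⟩
    simp only [Nat.add_sub_cancel, Nat.add_succ_sub_one]
    calc f x ^ (k + 1) ≤ (K * x) ^ (k + 1) := pow_le_pow_left₀ (hnn t) (hcK x hx).2 _
      _ = K ^ (k + 1) * x ^ k * x := by ring
      _ ≤ K ^ (k + 1) * r ^ k * t := by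
        have := hx.1
        have := pow_le_pow_left₀ hx.1 hx.2 k
        gcongr
      _ ≤ _ := mul_le_mul_of_nonneg_right (le_max_right _ _) ht

lemma exists_pow_eq_const_mul_pow {n m : ℕ} (hn : 2 ≤ n) (hm : 2 ≤ m) (hr : 0 < r)
    (hf : DifferentiableOn ℝ f (Icc 0 r)) (hg : DifferentiableOn ℝ g (Icc 0 r))
    (hf0 : f 0 = 0) (hg0 : g 0 = 0)
    (hf'0 : HasDerivWithinAt f 1 (Icc 0 r) 0) (hg'0 : HasDerivWithinAt g 1 (Icc 0 r) 0)
    (hfpos : ∀ t ∈ Ioc 0 r, 0 < f t) (hgpos : ∀ t ∈ Ioc 0 r, 0 < g t)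
    (hcomp : ∀ t ∈ Ioo 0 r, ((m : ℝ) - 1) * (derivWithin g (Icc 0 r) t / g t) ≤
      ((n : ℝ) - 1) * (derivWithin f (Icc 0 r) t / f t))
    (heq : mu n f (Ioo 0 r) = mu m g (Ioo 0 r)) :
    ∃ c : ℝ, 0 < c ∧ ∀ t ∈ Ioo 0 r, f t ^ (n - 1) = c * g t ^ (m - 1) := by
  obtain ⟨C, hp⟩ := exists_conicalWeight hr hf.continuousOn hf0 hf'0 hfpos hn
  obtain ⟨C', hq⟩ := exists_conicalWeight hr hg.continuousOn hg0 hg'0 hgpos hm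
  have hclamp (t : ℝ) (ht : t ∈ Ioo 0 r) : max 0 (min r t) = t := by
    rw [min_eq_right ht.2.le, max_eq_right ht.1.le]
  have hp2 : mu n f (Ioo 0 r) = mu 2 (fun t => f (max 0 (min r t)) ^ (n - 1)) (Ioo 0 r) :=
    mu_congr_weight measurableSet_Ioo fun t ht => by simp [hclamp t ht]
  have hq2 : mu m g (Ioo 0 r) = mu 2 (fun t => g (max 0 (min r t)) ^ (m - 1)) (Ioo 0 r) :=
    mu_congr_weight measurableSet_Ioo fun t ht => by simp [hclamp t ht]
  rw [hp2, hq2] at heq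
  have hnhds (t : ℝ) (ht : t ∈ Ioo 0 r) : Icc 0 r ∈ 𝓝 t := Icc_mem_nhds ht.1 ht.2
  set R : ℝ → ℝ := fun t => f t ^ (n - 1) / g t ^ (m - 1) with hR
  have hRd : ∀ t ∈ Ioo 0 r, HasDerivAt R (R t * (((n : ℝ) - 1) *
      (derivWithin f (Icc 0 r) t / f t) - ((m : ℝ) - 1) *
        (derivWithin g (Icc 0 r) t / g t))) t := by
    intro t ht
    have hft := (hfpos t (Ioo_subset_Ioc_self ht)).ne'
    have hgt := (hgpos t (Ioo_subset_Ioc_self ht)).ne'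
    have h₁ := (hf t (Ioo_subset_Icc_self ht)).hasDerivWithinAt.hasDerivAt (hnhds t ht)
    have h₂ := (hg t (Ioo_subset_Icc_self ht)).hasDerivWithinAt.hasDerivAt (hnhds t ht)
    refine ((h₁.fun_pow (n - 1)).fun_div (h₂.fun_pow (m - 1)) (pow_ne_zero _ hgt)).congr_deriv ?_
    obtain ⟨k, rfl⟩ : ∃ k, n = k + 2 := ⟨n - 2, by omega⟩
    obtain ⟨l, rfl⟩ : ∃ l, m = l + 2 := ⟨m - 2, by omega⟩
    simp only [hR, Nat.add_succ_sub_one, Nat.add_sub_cancel]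
    push_cast
    field_simp
    ring
  have hRpos (t : ℝ) (ht : t ∈ Ioo 0 r) : 0 < R t :=
    div_pos (pow_pos (hfpos t (Ioo_subset_Ioc_self ht)) _)
      (pow_pos (hgpos t (Ioo_subset_Ioc_self ht)) _)
  have hzero := hp.deriv_ratio_eq_zero hq hr heq
    (fun t ht => (hRd t ht).congr_of_eventuallyEq <| by
      filter_upwards [Ioo_mem_nhds ht.1 ht.2] with s hs
      simp only [hR, hclamp s hs])
    (fun t ht => mul_nonneg (hRpos t ht).le (sub_nonneg.2 (hcomp t ht)))
  obtain ⟨c, hc⟩ := isOpen_Ioo.exists_is_const_of_deriv_eq_zero isPreconnected_Ioo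
    (fun t ht => (hRd t ht).differentiableAt.differentiableWithinAt)
    (fun t ht => (hRd t ht).deriv.trans (hzero t ht))
  have hmid : r / 2 ∈ Ioo 0 r := ⟨by linarith, by linarith⟩
  refine ⟨c, hc _ hmid ▸ hRpos _ hmid, fun t ht => ?_⟩
  rw [← hc t ht, hR]
  exact (div_mul_cancel₀ _ (pow_pos (hgpos t (Ioo_subset_Ioc_self ht)) _).ne').symm

lemma le_of_pow_eq_const_mul_pow {k l : ℕ} (hr : 0 < r) (hf0 : f 0 = 0) (hg0 : g 0 = 0)
    (hf'0 : HasDerivWithinAt f 1 (Icc 0 r) 0) (hg'0 : HasDerivWithinAt g 1 (Icc 0 r) 0)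
    {c : ℝ} (hc : 0 < c) (h : ∀ t ∈ Ioo 0 r, f t ^ k = c * g t ^ l) : k ≤ l := by
  by_contra! hlt
  obtain ⟨d, rfl⟩ := Nat.exists_eq_add_of_lt hlt
  have hF := (tendsto_div_self_of_hasDerivWithinAt hr hf0 hf'0).pow (l + d + 1)
  have hG := ((tendsto_div_self_of_hasDerivWithinAt hr hg0 hg'0).pow l).const_mul c
  have hid : Tendsto (fun t : ℝ => t ^ (d + 1)) (𝓝[>] 0) (𝓝 0) := by
    have : Tendsto (fun t : ℝ => t ^ (d + 1)) (𝓝 0) (𝓝 (0 ^ (d + 1))) :=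
      (continuous_pow (d + 1)).tendsto 0
    rw [zero_pow d.succ_ne_zero] at this
    exact this.mono_left nhdsWithin_le_nhds
  have hF' := hF.mul hid
  have := tendsto_nhds_unique hG (hF'.congr' <| by
    filter_upwards [Ioo_mem_nhdsGT hr] with t ht
    have ht0 := ht.1.ne'
    rw [div_pow, h t ht, div_pow]
    field_simp
    ring)
  simp at this
  exact hc.ne' this

lemma eq_one_of_pow_eq_const_mul_pow {k : ℕ} (hr : 0 < r) (hf0 : f 0 = 0) (hg0 : g 0 = 0)
    (hf'0 : HasDerivWithinAt f 1 (Icc 0 r) 0) (hg'0 : HasDerivWithinAt g 1 (Icc 0 r) 0)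
    {c : ℝ} (h : ∀ t ∈ Ioo 0 r, f t ^ k = c * g t ^ k) : c = 1 := by
  have hF := (tendsto_div_self_of_hasDerivWithinAt hr hf0 hf'0).pow k
  have hG := ((tendsto_div_self_of_hasDerivWithinAt hr hg0 hg'0).pow k).const_mul c
  have := tendsto_nhds_unique hG (hF.congr' <| by
    filter_upwards [Ioo_mem_nhdsGT hr] with t ht
    rw [div_pow, h t ht, div_pow, mul_div_assoc])
  simpa using this

lemma eq_of_pow_eq_const_mul_pow {n m : ℕ} (hn : 2 ≤ n) (hm : 2 ≤ m) (hr : 0 < r)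
    (hf : ContinuousOn f (Icc 0 r)) (hg : ContinuousOn g (Icc 0 r))
    (hf0 : f 0 = 0) (hg0 : g 0 = 0)
    (hf'0 : HasDerivWithinAt f 1 (Icc 0 r) 0) (hg'0 : HasDerivWithinAt g 1 (Icc 0 r) 0)
    (hfpos : ∀ t ∈ Ioc 0 r, 0 < f t) (hgpos : ∀ t ∈ Ioc 0 r, 0 < g t) {c : ℝ} (hc : 0 < c)
    (h : ∀ t ∈ Ioo 0 r, f t ^ (n - 1) = c * g t ^ (m - 1)) :
    n = m ∧ EqOn f g (Icc 0 r) := by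
  have h₁ := le_of_pow_eq_const_mul_pow hr hf0 hg0 hf'0 hg'0 hc h
  have h₂ := le_of_pow_eq_const_mul_pow hr hg0 hf0 hg'0 hf'0 (inv_pos.2 hc) fun t ht => by
    rw [h t ht, inv_mul_cancel_left₀ hc.ne']
  obtain rfl : n = m := by omega
  obtain rfl := eq_one_of_pow_eq_const_mul_pow hr hf0 hg0 hf'0 hg'0 h
  refine ⟨rfl, ?_⟩
  have hEq : EqOn f g (Ioo 0 r) := fun t ht =>
    (pow_left_inj₀ (hfpos t (Ioo_subset_Ioc_self ht)).le (hgpos t (Ioo_subset_Ioc_self ht)).le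
      (by omega : n - 1 ≠ 0)).1 (by rw [h t ht, one_mul])
  exact hEq.of_subset_closure hf hg Ioo_subset_Icc_self (closure_Ioo hr.ne).ge

end WarpingFunction

/-- rigidity in Theorem 3.1, rotationally symmetric case: under the
hypotheses of Theorem 3.1, if `μ_n(f, r) = μ_m(g, r)` then `n = m` and `f = g` on
`[0, r]`. -/
theorem stmt8 (n m : ℕ) (hn : 2 ≤ n) (hm : 2 ≤ m) (r : ℝ) (hr : 0 < r)
    (f g : ℝ → ℝ) (hf : ContDiffOn ℝ (⊤ : ℕ∞) f (Set.Icc 0 r)) (hg : ContDiffOn ℝ (⊤ : ℕ∞) g (Set.Icc 0 r))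
    (hf0 : f 0 = 0) (hg0 : g 0 = 0)
    (hf'0 : derivWithin f (Set.Icc 0 r) 0 = 1) (hg'0 : derivWithin g (Set.Icc 0 r) 0 = 1)
    (hfpos : ∀ t ∈ Set.Ioc 0 r, 0 < f t) (hgpos : ∀ t ∈ Set.Ioc 0 r, 0 < g t)
    (hcomp :
      (∀ t ∈ Set.Ioo 0 r,
        ((m : ℝ) - 1) * (derivWithin g (Set.Icc 0 r) t / g t) ≤
          ((n : ℝ) - 1) * (derivWithin f (Set.Icc 0 r) t / f t)) ∨
      (∀ t ∈ Set.Ioo 0 r,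
        ((n : ℝ) - 1) * (derivWithin f (Set.Icc 0 r) t / f t) ≤
          ((m : ℝ) - 1) * (derivWithin g (Set.Icc 0 r) t / g t)))
    (heq : mu n f (Set.Ioo 0 r) = mu m g (Set.Ioo 0 r)) :
    n = m ∧ ∀ t ∈ Set.Icc 0 r, f t = g t := by
  have hfd := hf.differentiableOn (by simp)
  have hgd := hg.differentiableOn (by simp)
  have h0 : (0 : ℝ) ∈ Icc 0 r := left_mem_Icc.2 hr.le
  have hf₁ : HasDerivWithinAt f 1 (Icc 0 r) 0 := hf'0 ▸ (hfd 0 h0).hasDerivWithinAt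
  have hg₁ : HasDerivWithinAt g 1 (Icc 0 r) 0 := hg'0 ▸ (hgd 0 h0).hasDerivWithinAt
  rcases hcomp with hcomp | hcomp
  · obtain ⟨c, hc, h⟩ := exists_pow_eq_const_mul_pow hn hm hr hfd hgd hf0 hg0 hf₁ hg₁ hfpos hgpos
      hcomp heq
    exact eq_of_pow_eq_const_mul_pow hn hm hr hfd.continuousOn hgd.continuousOn hf0 hg0 hf₁ hg₁
      hfpos hgpos hc h
  · obtain ⟨c, hc, h⟩ := exists_pow_eq_const_mul_pow hm hn hr hgd hfd hg0 hf0 hg₁ hf₁ hgpos hfpos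
      hcomp heq.symm
    obtain ⟨hmn, hgf⟩ := eq_of_pow_eq_const_mul_pow hm hn hr hgd.continuousOn hfd.continuousOn
      hg0 hf0 hg₁ hf₁ hgpos hfpos hc h
    exact ⟨hmn.symm, hgf.symm⟩
end

section
/- Let n ≥ 2 and m ≥ 2 be integers. Let f, g : [0, ∞) → ℝ be smooth with f(0) = g(0) = 0, f′(0) = g′(0) = 1, and f(t) > 0, g(t) > 0 for all t > 0. If (n−1)f′(t)/f(t) ≥ (m−1)g′(t)/g(t) for all t > 0, then μ_n(f, ∞) ≥ μ_m(g, ∞). -/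
open scoped ENNReal Topology
open MeasureTheory

/-- On compact intervals starting at a zero of a `C¹` function, positive powers of the function
are bounded by a multiple of the distance to the zero. -/
lemma exists_pow_le_mul {g : ℝ → ℝ} (hg : ContDiffOn ℝ 1 g (Set.Ici 0)) (hg0 : g 0 = 0)
    (hgpos : ∀ t : ℝ, 0 < t → 0 < g t) {k : ℕ} (hk : 1 ≤ k) {b : ℝ} (hb : 0 < b) :
    ∃ C : ℝ, 0 ≤ C ∧ ∀ t, 0 < t → t ≤ b → g t ^ k ≤ C * t := by
  have hg1 : ContDiffOn ℝ 1 g (Set.Icc 0 b) := hg.mono Set.Icc_subset_Ici_self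
  have hcont : ContinuousOn (derivWithin g (Set.Icc 0 b)) (Set.Icc 0 b) :=
    hg1.continuousOn_derivWithin (uniqueDiffOn_Icc hb) le_rfl
  obtain ⟨K, hK⟩ := isCompact_Icc.exists_bound_of_continuousOn hcont
  have hK0 : 0 ≤ K := (norm_nonneg _).trans (hK 0 ⟨le_rfl, hb.le⟩)
  have hlip : ∀ t, 0 < t → t ≤ b → g t ≤ K * t := by
    intro t ht htb
    have h := (convex_Icc (0 : ℝ) b).norm_image_sub_le_of_norm_derivWithin_le
      (hg1.differentiableOn one_ne_zero) hK ⟨le_rfl, hb.le⟩ ⟨ht.le, htb⟩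
    rw [hg0, sub_zero, sub_zero, Real.norm_eq_abs, Real.norm_eq_abs, abs_of_pos ht] at h
    exact (le_abs_self _).trans h
  obtain ⟨j, rfl⟩ : ∃ j, k = j + 1 := ⟨k - 1, by omega⟩
  refine ⟨(K * b) ^ j * K, by positivity, fun t ht htb => ?_⟩
  have h1 : g t ≤ K * b := (hlip t ht htb).trans (by gcongr)
  calc g t ^ (j + 1) = g t ^ j * g t := pow_succ _ _
    _ ≤ (K * b) ^ j * (K * t) :=
        mul_le_mul (pow_le_pow_left₀ (hgpos t ht).le h1 j) (hlip t ht htb)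
          (hgpos t ht).le (by positivity)
    _ = (K * b) ^ j * K * t := by ring

/-- The derivative of the smooth transition function is bounded on the unit interval. -/
lemma exists_bound_deriv_smoothTransition :
    ∃ M : ℝ, ∀ x ∈ Set.Icc (0 : ℝ) 1, |deriv Real.smoothTransition x| ≤ M := by
  have hcont : Continuous (deriv Real.smoothTransition) :=
    (Real.smoothTransition.contDiff (n := 1)).continuous_deriv le_rfl
  obtain ⟨M, hM⟩ := (isCompact_Icc (a := (0 : ℝ)) (b := 1)).exists_bound_of_continuousOn
    hcont.continuousOn
  exact ⟨M, hM⟩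

/-- The logarithmic cutoff, equal to `0` on `(-∞, s e^{-L}]` and to `1` on `[s, ∞)`. -/
noncomputable def logCutoff (s L t : ℝ) : ℝ :=
  if 0 < t then Real.smoothTransition (1 + (Real.log t - Real.log s) / L) else 0

lemma logCutoff_of_le {s L t : ℝ} (hs : 0 < s) (hL : 0 < L) (ht : t ≤ s * Real.exp (-L)) :
    logCutoff s L t = 0 := by
  unfold logCutoff
  split_ifs with h
  · refine Real.smoothTransition.zero_of_nonpos ?_
    have h1 := Real.log_le_log h ht
    rw [Real.log_mul hs.ne' (Real.exp_pos _).ne', Real.log_exp] at h1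
    have : (Real.log t - Real.log s) / L ≤ -1 := by rw [div_le_iff₀ hL]; linarith
    linarith
  · rfl

lemma logCutoff_of_ge {s L t : ℝ} (hs : 0 < s) (hL : 0 < L) (ht : s ≤ t) :
    logCutoff s L t = 1 := by
  unfold logCutoff
  rw [if_pos (hs.trans_le ht)]
  refine Real.smoothTransition.one_of_one_le ?_
  have h1 := Real.log_le_log hs ht
  have : 0 ≤ (Real.log t - Real.log s) / L := div_nonneg (by linarith) hL.le
  linarith

lemma contDiff_logCutoff {s L : ℝ} (hs : 0 < s) (hL : 0 < L) :
    ContDiff ℝ (⊤ : ℕ∞) (logCutoff s L) := by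
  rw [contDiff_iff_contDiffAt]
  intro t
  rcases lt_or_ge 0 t with ht | ht
  · have h : ContDiffAt ℝ (⊤ : ℕ∞)
        (fun t => Real.smoothTransition (1 + (Real.log t - Real.log s) / L)) t := by
      refine ContDiffAt.comp t Real.smoothTransition.contDiffAt ?_
      exact contDiffAt_const.add
        (((Real.contDiffAt_log.2 ht.ne').sub contDiffAt_const).div_const _)
    refine h.congr_of_eventuallyEq ?_
    filter_upwards [lt_mem_nhds ht] with x hx
    simp [logCutoff, hx]
  · have h0 : t < s * Real.exp (-L) := ht.trans_lt (by positivity)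
    refine (contDiffAt_const (c := (0 : ℝ))).congr_of_eventuallyEq ?_
    filter_upwards [gt_mem_nhds h0] with x hx
    exact logCutoff_of_le hs hL hx.le

lemma abs_deriv_logCutoff_le {s L M t : ℝ} (hs : 0 < s) (hL : 0 < L)
    (hM : ∀ x ∈ Set.Icc (0 : ℝ) 1, |deriv Real.smoothTransition x| ≤ M)
    (ht : s * Real.exp (-L) ≤ t) (hts : t ≤ s) :
    |deriv (logCutoff s L) t| ≤ M / (L * t) := by
  have ht0 : 0 < t := lt_of_lt_of_le (by positivity) ht
  set x := 1 + (Real.log t - Real.log s) / L with hx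
  have hinner : HasDerivAt (fun t => 1 + (Real.log t - Real.log s) / L) (t⁻¹ / L) t :=
    (((Real.hasDerivAt_log ht0.ne').sub_const _).div_const L).const_add 1
  have houter : HasDerivAt Real.smoothTransition (deriv Real.smoothTransition x) x :=
    ((Real.smoothTransition.contDiffAt (n := 1)).differentiableAt one_ne_zero).hasDerivAt
  have hd : HasDerivAt (logCutoff s L) (deriv Real.smoothTransition x * (t⁻¹ / L)) t := by
    refine (HasDerivAt.comp t houter hinner).congr_of_eventuallyEq ?_
    filter_upwards [lt_mem_nhds ht0] with y hy
    simp [logCutoff, hy]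
  have hxm : x ∈ Set.Icc (0 : ℝ) 1 := by
    have h1 := Real.log_le_log (by positivity) ht
    rw [Real.log_mul hs.ne' (Real.exp_pos _).ne', Real.log_exp] at h1
    have h2 := Real.log_le_log ht0 hts
    have h3 : -1 ≤ (Real.log t - Real.log s) / L := by rw [le_div_iff₀ hL]; linarith
    have h4 : (Real.log t - Real.log s) / L ≤ 0 :=
      div_nonpos_of_nonpos_of_nonneg (by linarith) hL.le
    constructor <;> linarith
  rw [hd.deriv, abs_mul, abs_of_pos (a := t⁻¹ / L) (by positivity)]
  calc |deriv Real.smoothTransition x| * (t⁻¹ / L) ≤ M * (t⁻¹ / L) := by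
        gcongr; exact hM x hxm
    _ = M / (L * t) := by field_simp

/-- The energy of the logarithmic cutoff with respect to a weight that is at most linear. -/
lemma integral_deriv_logCutoff_sq_le {s L M C : ℝ} (hs : 0 < s) (hL : 0 < L)
    (hM : ∀ x ∈ Set.Icc (0 : ℝ) 1, |deriv Real.smoothTransition x| ≤ M) {W : ℝ → ℝ}
    (hWc : ContinuousOn W (Set.Ioi 0)) (hWC : ∀ t, 0 < t → t ≤ s → W t ≤ C * t) (hC : 0 ≤ C) :
    ∫ t in (s * Real.exp (-L))..s, deriv (logCutoff s L) t ^ 2 * W t ≤ C * M ^ 2 / L := by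
  have ha0 : 0 < s * Real.exp (-L) := by positivity
  have has : s * Real.exp (-L) ≤ s :=
    mul_le_of_le_one_right hs.le (Real.exp_le_one_iff.2 (by linarith))
  have hsub : Set.uIcc (s * Real.exp (-L)) s ⊆ Set.Ioi 0 := by
    rw [Set.uIcc_of_le has]
    exact fun x hx => ha0.trans_le hx.1
  have hdc : Continuous (deriv (logCutoff s L)) :=
    (contDiff_logCutoff hs hL).continuous_deriv (by exact_mod_cast le_top)
  calc ∫ t in (s * Real.exp (-L))..s, deriv (logCutoff s L) t ^ 2 * W t
      ≤ ∫ t in (s * Real.exp (-L))..s, C * M ^ 2 / L ^ 2 * t⁻¹ := by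
        refine intervalIntegral.integral_mono_on has ?_ ?_ fun t ht => ?_
        · exact ((hdc.pow 2).continuousOn.mul (hWc.mono hsub)).intervalIntegrable
        · exact (continuousOn_const.mul
            (continuousOn_inv₀.mono fun x hx => (hsub hx).ne')).intervalIntegrable
        · have ht0 : 0 < t := ha0.trans_le ht.1
          calc deriv (logCutoff s L) t ^ 2 * W t
              ≤ deriv (logCutoff s L) t ^ 2 * (C * t) := by
                gcongr; exact hWC t ht0 ht.2
            _ ≤ (M / (L * t)) ^ 2 * (C * t) := by
                gcongr ?_ * _
                rw [← sq_abs]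
                exact pow_le_pow_left₀ (abs_nonneg _)
                  (abs_deriv_logCutoff_le hs hL hM ht.1 ht.2) 2
            _ = C * M ^ 2 / L ^ 2 * t⁻¹ := by field_simp
    _ = C * M ^ 2 / L := by
        rw [intervalIntegral.integral_const_mul, integral_inv_of_pos ha0 hs]
        have : s / (s * Real.exp (-L)) = Real.exp L := by
          rw [Real.exp_neg]; field_simp
        rw [this, Real.log_exp]
        field_simp

/-- A smooth function agreeing with `φ` on `[r, ∞)`, constant on `(-∞, s]`, whose derivative is
nowhere larger than that of `φ`. -/
lemma exists_flattening {φ : ℝ → ℝ} (hφ : ContDiff ℝ (⊤ : ℕ∞) φ) {s r : ℝ} (hsr : s < r) :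
    ∃ u : ℝ → ℝ, ContDiff ℝ (⊤ : ℕ∞) u ∧ (∀ t, r ≤ t → u t = φ t) ∧ (∀ t ≤ s, u t = u s) ∧
      ∀ t, deriv u t ^ 2 ≤ deriv φ t ^ 2 := by
  set χ : ℝ → ℝ := fun t => Real.smoothTransition ((t - s) / (r - s)) with hχ
  have hχs : ContDiff ℝ (⊤ : ℕ∞) χ :=
    Real.smoothTransition.contDiff.comp ((contDiff_id.sub contDiff_const).div_const _)
  have hχ0 : ∀ t ≤ s, χ t = 0 := fun t ht => Real.smoothTransition.zero_of_nonpos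
    (div_nonpos_of_nonpos_of_nonneg (by linarith) (by linarith))
  have hχ1 : ∀ t, r ≤ t → χ t = 1 := fun t ht => Real.smoothTransition.one_of_one_le
    ((one_le_div (by linarith)).2 (by linarith))
  have hφ' : ContDiff ℝ (⊤ : ℕ∞) (deriv φ) := (contDiff_infty_iff_deriv.1 hφ).2
  have hp : ContDiff ℝ (⊤ : ℕ∞) (fun t => deriv φ t * χ t) := hφ'.mul hχs
  set u : ℝ → ℝ := fun t => φ r + ∫ x in r..t, deriv φ x * χ x with hu
  have hud : ∀ t, HasDerivAt u (deriv φ t * χ t) t := fun t =>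
    (intervalIntegral.integral_hasDerivAt_right (hp.continuous.intervalIntegrable _ _)
      hp.continuous.stronglyMeasurable.stronglyMeasurableAtFilter
      hp.continuous.continuousAt).const_add _
  have hderiv : deriv u = fun t => deriv φ t * χ t := funext fun t => (hud t).deriv
  refine ⟨u, ?_, fun t ht => ?_, fun t ht => ?_, fun t => ?_⟩
  · exact contDiff_infty_iff_deriv.2 ⟨fun t => (hud t).differentiableAt, hderiv ▸ hp⟩
  · have h1 : ∫ x in r..t, deriv φ x * χ x = ∫ x in r..t, deriv φ x := by
      refine intervalIntegral.integral_congr fun x hx => ?_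
      rw [Set.uIcc_of_le ht] at hx
      simp [hχ1 x hx.1]
    have h2 : ∫ x in r..t, deriv φ x = φ t - φ r :=
      intervalIntegral.integral_deriv_eq_sub
        (fun x _ => (hφ.differentiable (by simp)).differentiableAt)
        (hφ'.continuous.intervalIntegrable _ _)
    simp only [hu, h1, h2]
    ring
  · have h1 : ∫ x in s..t, deriv φ x * χ x = 0 := by
      refine (intervalIntegral.integral_congr (g := fun _ => (0 : ℝ)) fun x hx => ?_).trans
        (by simp)
      rw [Set.uIcc_of_ge ht] at hx
      simp [hχ0 x hx.2]
    have h2 := intervalIntegral.integral_add_adjacent_intervals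
      (hp.continuous.intervalIntegrable (μ := volume) r s)
      (hp.continuous.intervalIntegrable (μ := volume) s t)
    simp only [hu]
    rw [← h2, h1, add_zero]
  · rw [hderiv, mul_pow]
    exact mul_le_of_le_one_right (sq_nonneg _)
      (pow_le_one₀ (Real.smoothTransition.nonneg _) (Real.smoothTransition.le_one _))

/-- The Poincaré inequality with weight `W` and constant `c` for smooth functions with compact
support in `(0, ∞)`. -/
def WeightedPoincare (W : ℝ → ℝ) (c : ℝ) : Prop :=
  ∀ ψ : ℝ → ℝ, ContDiff ℝ (⊤ : ℕ∞) ψ → ∀ a b : ℝ, 0 < a → a ≤ b → (∀ t ≤ a, ψ t = 0) →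
    (∀ t, b ≤ t → ψ t = 0) →
    c * ∫ t in a..b, ψ t ^ 2 * W t ≤ ∫ t in a..b, deriv ψ t ^ 2 * W t

/-- For a weight vanishing at least linearly at `0`, the Poincaré inequality on `(0, ∞)` implies
the one on `(s, b)` with a free boundary at `s`. -/
lemma WeightedPoincare.free_boundary {W : ℝ → ℝ} {c : ℝ} (hP : WeightedPoincare W c) (hc : 0 ≤ c)
    (hWc : ContinuousOn W (Set.Ioi 0)) (hW0 : ∀ t, 0 < t → 0 ≤ W t)
    {b C : ℝ} (hC : 0 ≤ C) (hWC : ∀ t, 0 < t → t ≤ b → W t ≤ C * t)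
    {φ : ℝ → ℝ} (hφ : ContDiff ℝ (⊤ : ℕ∞) φ) (hφb : ∀ t, b ≤ t → φ t = 0)
    {s : ℝ} (hs : 0 < s) (hsb : s < b) :
    c * ∫ t in s..b, φ t ^ 2 * W t ≤ ∫ t in s..b, deriv φ t ^ 2 * W t := by
  obtain ⟨M, hM⟩ := exists_bound_deriv_smoothTransition
  have hInt : ∀ {v : ℝ → ℝ}, Continuous v → ∀ {x y : ℝ}, 0 < x → 0 < y →
      IntervalIntegrable (fun t => v t ^ 2 * W t) volume x y := by
    intro v hv x y hx hy
    refine ((hv.pow 2).continuousOn.mul (hWc.mono ?_)).intervalIntegrable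
    exact fun z hz => (lt_min hx hy).trans_le hz.1
  have hnonneg : ∀ (v : ℝ → ℝ) {x y : ℝ}, 0 < x → x ≤ y →
      0 ≤ ∫ t in x..y, v t ^ 2 * W t := by
    intro v x y hx hxy
    exact intervalIntegral.integral_nonneg hxy fun t ht =>
      mul_nonneg (sq_nonneg _) (hW0 t (hx.trans_le ht.1))
  have hcd : ∀ {v : ℝ → ℝ}, ContDiff ℝ (⊤ : ℕ∞) v → Continuous (deriv v) := fun hv =>
    hv.continuous_deriv (by exact_mod_cast le_top)
  have hb : 0 < b := hs.trans hsb
  have key : ∀ r, s < r → r < b →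
      c * ∫ t in r..b, φ t ^ 2 * W t ≤ ∫ t in s..b, deriv φ t ^ 2 * W t := by
    intro r hsr hrb
    have hr : 0 < r := hs.trans hsr
    obtain ⟨u, hu, hur, hus, hud⟩ := exists_flattening hφ hsr
    have hL : ∀ L : ℝ, 0 < L → c * ∫ t in r..b, φ t ^ 2 * W t ≤
        u s ^ 2 * (C * M ^ 2 / L) + ∫ t in s..b, deriv φ t ^ 2 * W t := by
      intro L hL
      set a := s * Real.exp (-L) with ha
      have ha0 : 0 < a := by positivity
      have has : a ≤ s :=
        mul_le_of_le_one_right hs.le (Real.exp_le_one_iff.2 (by linarith))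
      set ψ : ℝ → ℝ := fun t => logCutoff s L t * u t with hψ
      have hη := contDiff_logCutoff hs hL
      have hψs : ContDiff ℝ (⊤ : ℕ∞) ψ := hη.mul hu
      have h1 := hP ψ hψs a b ha0 (has.trans hsb.le)
        (fun t ht => by simp [hψ, logCutoff_of_le hs hL ht])
        (fun t ht => by simp [hψ, hur t (hrb.le.trans ht), hφb t ht])
      have h2 : ∫ t in r..b, φ t ^ 2 * W t ≤ ∫ t in a..b, ψ t ^ 2 * W t := by
        rw [← intervalIntegral.integral_add_adjacent_intervals
          (hInt hψs.continuous ha0 hr) (hInt hψs.continuous hr hb)]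
        have h3 : ∫ t in r..b, ψ t ^ 2 * W t = ∫ t in r..b, φ t ^ 2 * W t := by
          refine intervalIntegral.integral_congr fun t ht => ?_
          rw [Set.uIcc_of_le hrb.le] at ht
          simp [hψ, logCutoff_of_ge hs hL (hsr.le.trans ht.1), hur t ht.1]
        linarith [hnonneg ψ ha0 (has.trans hsr.le)]
      have hlow : ∫ t in a..s, deriv ψ t ^ 2 * W t ≤ u s ^ 2 * (C * M ^ 2 / L) := by
        have h4 : ∫ t in a..s, deriv ψ t ^ 2 * W t
            = ∫ t in a..s, u s ^ 2 * (deriv (logCutoff s L) t ^ 2 * W t) := by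
          refine intervalIntegral.integral_congr_Ioo_of_le has fun t ht => ?_
          have h5 : ψ =ᶠ[𝓝 t] fun x => logCutoff s L x * u s := by
            filter_upwards [gt_mem_nhds ht.2] with x hx
            simp only [hψ, hus x hx.le]
          have h6 : deriv ψ t = deriv (logCutoff s L) t * u s := by
            rw [h5.deriv_eq, deriv_mul_const_field]
          simp only [h6]
          ring
        rw [h4, intervalIntegral.integral_const_mul]
        gcongr
        exact integral_deriv_logCutoff_sq_le hs hL hM hWc
          (fun t ht hts => hWC t ht (hts.trans hsb.le)) hC
      have hhigh : ∫ t in s..b, deriv ψ t ^ 2 * W t ≤ ∫ t in s..b, deriv φ t ^ 2 * W t := by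
        refine intervalIntegral.integral_mono_on_of_le_Ioo hsb.le
          (hInt (hcd hψs) hs hb) (hInt (hcd hφ) hs hb) fun t ht => ?_
        have h5 : ψ =ᶠ[𝓝 t] u := by
          filter_upwards [lt_mem_nhds ht.1] with x hx
          simp [hψ, logCutoff_of_ge hs hL hx.le]
        rw [h5.deriv_eq]
        exact mul_le_mul_of_nonneg_right (hud t) (hW0 t (hs.trans ht.1))
      rw [← intervalIntegral.integral_add_adjacent_intervals
          (hInt (hcd hψs) ha0 hs) (hInt (hcd hψs) hs hb)] at h1
      linarith [mul_le_mul_of_nonneg_left h2 hc]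
    have hlim : Filter.Tendsto (fun L : ℝ => u s ^ 2 * (C * M ^ 2 / L) +
        ∫ t in s..b, deriv φ t ^ 2 * W t) Filter.atTop
        (𝓝 (u s ^ 2 * 0 + ∫ t in s..b, deriv φ t ^ 2 * W t)) :=
      ((Filter.Tendsto.const_div_atTop Filter.tendsto_id _).const_mul _).add_const _
    rw [mul_zero, zero_add] at hlim
    refine ge_of_tendsto hlim ?_
    filter_upwards [Filter.eventually_gt_atTop 0] with L hL0 using hL L hL0
  have hcont : ContinuousAt (fun r => ∫ t in r..b, φ t ^ 2 * W t) s := by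
    have hco : ContinuousOn (fun t => φ t ^ 2 * W t) (Set.Ioi 0) :=
      (hφ.continuous.pow 2).continuousOn.mul hWc
    exact (intervalIntegral.integral_hasDerivAt_left (hInt hφ.continuous hs hb)
      (hco.stronglyMeasurableAtFilter isOpen_Ioi s hs)
      (hco.continuousAt (Ioi_mem_nhds hs))).continuousAt
  have hlim : Filter.Tendsto (fun r => c * ∫ t in r..b, φ t ^ 2 * W t) (𝓝[>] s)
      (𝓝 (c * ∫ t in s..b, φ t ^ 2 * W t)) :=
    (hcont.tendsto.mono_left nhdsWithin_le_nhds).const_mul c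
  refine le_of_tendsto hlim ?_
  filter_upwards [Ioo_mem_nhdsGT hsb] with r hr using key r hr.1 hr.2

/-- If all the tails of `∫ h` are nonnegative, so is the integral of `h` against a nonnegative
nondecreasing function. -/
lemma integral_mul_nonneg_of_tails_nonneg {h ρ ρ' : ℝ → ℝ} {a b : ℝ} (ha : 0 < a) (hab : a < b)
    (hh : ContinuousOn h (Set.Ioi 0)) (hρ : ∀ t, 0 < t → HasDerivAt ρ (ρ' t) t)
    (hρ' : ∀ t, 0 < t → 0 ≤ ρ' t) (hρa : 0 ≤ ρ a)
    (htail : ∀ s, 0 < s → s < b → 0 ≤ ∫ t in s..b, h t) :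
    0 ≤ ∫ t in a..b, h t * ρ t := by
  have hb : 0 < b := ha.trans hab
  have hρc : ContinuousOn ρ (Set.Ioi 0) := fun t ht => (hρ t ht).continuousAt.continuousWithinAt
  have hd : ∀ {k : ℝ → ℝ}, ContinuousOn k (Set.Ioi 0) → ∀ s, 0 < s →
      HasDerivAt (fun s => ∫ t in s..b, k t) (-k s) s := by
    intro k hk s hs
    exact intervalIntegral.integral_hasDerivAt_left
      ((hk.mono fun z hz => (lt_min hs hb).trans_le hz.1).intervalIntegrable)
      (hk.stronglyMeasurableAtFilter isOpen_Ioi s hs) (hk.continuousAt (Ioi_mem_nhds hs))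
  set G : ℝ → ℝ := fun s => (∫ t in s..b, h t * ρ t) - (∫ t in s..b, h t) * ρ s with hG
  have hGd : ∀ s, 0 < s → HasDerivAt G (-((∫ t in s..b, h t) * ρ' s)) s := by
    intro s hs
    refine ((hd (hh.mul hρc) s hs).fun_sub ((hd hh s hs).fun_mul (hρ s hs))).congr_deriv ?_
    simp only [Pi.mul_apply]
    ring
  have hanti : AntitoneOn G (Set.Icc a b) := by
    refine antitoneOn_of_deriv_nonpos (convex_Icc a b)
      (fun s hs => (hGd s (ha.trans_le hs.1)).continuousAt.continuousWithinAt)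
      (fun s hs => ?_) (fun s hs => ?_) <;> rw [interior_Icc] at hs
    · exact (hGd s (ha.trans hs.1)).differentiableAt.differentiableWithinAt
    · have hs0 := ha.trans hs.1
      rw [(hGd s hs0).deriv]
      exact neg_nonpos.2 (mul_nonneg (htail s hs0 hs.2) (hρ' s hs0))
  have h1 := hanti ⟨le_rfl, hab.le⟩ ⟨hab.le, le_rfl⟩ hab.le
  simp only [hG, intervalIntegral.integral_same, zero_mul, sub_zero] at h1
  linarith [mul_nonneg (htail a ha hab) hρa]

lemma deriv_eq_zero_of_eqOn_zero {ψ : ℝ → ℝ} {a b : ℝ} (hψ : ContDiff ℝ (⊤ : ℕ∞) ψ)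
    (ha : ∀ t ≤ a, ψ t = 0) (hb : ∀ t, b ≤ t → ψ t = 0) {t : ℝ} (ht : t ∉ Set.Ioc a b) :
    deriv ψ t = 0 := by
  have hdiff := (hψ.differentiable (by simp)) t
  rcases le_or_gt t a with h | h
  · rw [← hdiff.derivWithin (uniqueDiffOn_Iic a t h),
      derivWithin_congr (f := fun _ => (0 : ℝ)) (s := Set.Iic a) (fun x hx => ha x hx) (ha t h)]
    simp
  · have h' : b < t := by by_contra! hc; exact ht ⟨h, hc⟩
    rw [← hdiff.derivWithin (uniqueDiffOn_Ici b t h'.le),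
      derivWithin_congr (f := fun _ => (0 : ℝ)) (s := Set.Ici b) (fun x hx => hb x hx) (hb t h'.le)]
    simp

lemma setIntegral_Ioi_eq_intervalIntegral {F : ℝ → ℝ} {a b : ℝ} (ha : 0 < a) (hab : a ≤ b)
    (hF : ∀ t, t ∉ Set.Ioc a b → F t = 0) :
    ∫ t in Set.Ioi 0, F t = ∫ t in a..b, F t := by
  rw [intervalIntegral.integral_of_le hab]
  exact setIntegral_eq_of_subset_of_forall_sdiff_eq_zero measurableSet_Ioi
    (fun t ht => ha.trans ht.1) fun t ht => hF t ht.2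

lemma mu_numerator_eq {ψ W : ℝ → ℝ} {a b : ℝ} (hψ : ContDiff ℝ (⊤ : ℕ∞) ψ) (ha0 : 0 < a)
    (hab : a ≤ b) (ha : ∀ t ≤ a, ψ t = 0) (hb : ∀ t, b ≤ t → ψ t = 0) :
    ∫ t in Set.Ioi 0, deriv ψ t ^ 2 * W t = ∫ t in a..b, deriv ψ t ^ 2 * W t :=
  setIntegral_Ioi_eq_intervalIntegral ha0 hab fun t ht => by
    simp [deriv_eq_zero_of_eqOn_zero hψ ha hb ht]

lemma mu_denominator_eq {ψ W : ℝ → ℝ} {a b : ℝ} (ha0 : 0 < a)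
    (hab : a ≤ b) (ha : ∀ t ≤ a, ψ t = 0) (hb : ∀ t, b ≤ t → ψ t = 0) :
    ∫ t in Set.Ioi 0, ψ t ^ 2 * W t = ∫ t in a..b, ψ t ^ 2 * W t :=
  setIntegral_Ioi_eq_intervalIntegral ha0 hab fun t ht => by
    have : ψ t = 0 := by
      rcases le_or_gt t a with h | h
      · exact ha t h
      · exact hb t (le_of_not_ge fun hc => ht ⟨h, hc⟩)
    simp [this]

lemma mu_quotient_nonneg {n : ℕ} {w : ℝ → ℝ} (hw : ∀ t : ℝ, 0 < t → 0 < w t) (φ : ℝ → ℝ) :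
    0 ≤ (∫ t in Set.Ioi 0, deriv φ t ^ 2 * w t ^ (n - 1)) /
      ∫ t in Set.Ioi 0, φ t ^ 2 * w t ^ (n - 1) :=
  div_nonneg
    (setIntegral_nonneg measurableSet_Ioi fun t ht =>
      mul_nonneg (sq_nonneg _) (pow_nonneg (hw t ht).le _))
    (setIntegral_nonneg measurableSet_Ioi fun t ht =>
      mul_nonneg (sq_nonneg _) (pow_nonneg (hw t ht).le _))

lemma mu_Ioi_nonneg {n : ℕ} {w : ℝ → ℝ} (hw : ∀ t : ℝ, 0 < t → 0 < w t) :
    0 ≤ mu n w (Set.Ioi 0) := by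
  refine Real.sInf_nonneg ?_
  rintro q ⟨φ, -, -, -, -, rfl⟩
  exact mu_quotient_nonneg hw φ

lemma weightedPoincare_mu {n : ℕ} {w : ℝ → ℝ} (hw : ∀ t : ℝ, 0 < t → 0 < w t) :
    WeightedPoincare (fun t => w t ^ (n - 1)) (mu n w (Set.Ioi 0)) := by
  intro ψ hψ a b ha0 hab ha hb
  rw [← mu_numerator_eq hψ ha0 hab ha hb, ← mu_denominator_eq ha0 hab ha hb]
  have hnum : 0 ≤ ∫ t in Set.Ioi 0, deriv ψ t ^ 2 * w t ^ (n - 1) :=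
    setIntegral_nonneg measurableSet_Ioi fun t ht =>
      mul_nonneg (sq_nonneg _) (pow_nonneg (hw t ht).le _)
  have hden : 0 ≤ ∫ t in Set.Ioi 0, ψ t ^ 2 * w t ^ (n - 1) :=
    setIntegral_nonneg measurableSet_Ioi fun t ht =>
      mul_nonneg (sq_nonneg _) (pow_nonneg (hw t ht).le _)
  rcases hden.eq_or_lt with h0 | hpos
  · rw [← h0, mul_zero]
    exact hnum
  rw [← le_div_iff₀ hpos]
  have hsupp : tsupport ψ ⊆ Set.Icc a b := by
    refine closure_minimal (fun t ht => ?_) isClosed_Icc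
    by_contra hc
    rcases lt_or_ge t a with h | h
    · exact ht (ha t h.le)
    · exact ht (hb t (le_of_not_ge fun h' => hc ⟨h, h'⟩))
  refine csInf_le ⟨0, ?_⟩ ⟨ψ, hψ, ?_, ?_, ?_, rfl⟩
  · rintro q ⟨φ, -, -, -, -, rfl⟩
    exact mu_quotient_nonneg hw φ
  · exact HasCompactSupport.of_support_subset_isCompact isCompact_Icc
      ((subset_tsupport ψ).trans hsupp)
  · exact hsupp.trans fun t ht => ha0.trans_le ht.1
  · rintro rfl
    simp at hpos

lemma exists_bounds_of_tsupport_subset_Ioi {φ : ℝ → ℝ} (hc : HasCompactSupport φ)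
    (hs : tsupport φ ⊆ Set.Ioi 0) :
    ∃ a b : ℝ, 0 < a ∧ a < b ∧ (∀ t ≤ a, φ t = 0) ∧ ∀ t, b ≤ t → φ t = 0 := by
  obtain ⟨b, hb⟩ := hc.isCompact.bddAbove
  have hφ : ∀ t, t ∉ tsupport φ → φ t = 0 := fun t => image_eq_zero_of_notMem_tsupport
  rcases (tsupport φ).eq_empty_or_nonempty with he | hne
  · exact ⟨1, 2, one_pos, one_lt_two, fun t _ => hφ t (by simp [he]),
      fun t _ => hφ t (by simp [he])⟩
  obtain ⟨x, hx, hmin⟩ := hc.isCompact.exists_isLeast hne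
  have hx0 : 0 < x := hs hx
  have hxb : x ≤ b := hb hx
  refine ⟨x / 2, b + 1, by linarith, by linarith, fun t ht => hφ t fun h => ?_,
    fun t ht => hφ t fun h => ?_⟩
  · linarith [hmin h]
  · linarith [hb h]

lemma integral_sq_mul_pos {φ W : ℝ → ℝ} (hφ : Continuous φ)
    (hWc : ContinuousOn W (Set.Ioi 0)) (hW : ∀ t, 0 < t → 0 < W t) (hne : φ ≠ 0)
    {a b : ℝ} (ha0 : 0 < a) (hab : a < b)
    (ha : ∀ t ≤ a, φ t = 0) (hb : ∀ t, b ≤ t → φ t = 0) :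
    0 < ∫ t in a..b, φ t ^ 2 * W t := by
  obtain ⟨x, hx⟩ := Function.ne_iff.1 hne
  have hxa : a < x := not_le.1 fun h => hx (ha x h)
  have hxb : x < b := not_le.1 fun h => hx (hb x h)
  refine intervalIntegral.integral_pos hab ?_ (fun t ht => ?_) ⟨x, ⟨hxa.le, hxb.le⟩, ?_⟩
  · exact (hφ.pow 2).continuousOn.mul (hWc.mono fun t ht => ha0.trans_le ht.1)
  · exact mul_nonneg (sq_nonneg _) (hW t (ha0.trans ht.1)).le
  · exact mul_pos (sq_pos_of_ne_zero hx) (hW x (ha0.trans hxa))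

lemma hasDerivAt_pow_div_pow {f g : ℝ → ℝ} {f' g' t : ℝ} {k l : ℕ} (hf : HasDerivAt f f' t)
    (hg : HasDerivAt g g' t) (hft : f t ≠ 0) (hgt : g t ≠ 0) :
    HasDerivAt (fun t => f t ^ k / g t ^ l)
      (f t ^ k / g t ^ l * (k * (f' / f t) - l * (g' / g t))) t := by
  have hpow : ∀ {p : ℝ → ℝ} {p' : ℝ} {j : ℕ}, HasDerivAt p p' t → p t ≠ 0 →
      HasDerivAt (fun t => p t ^ j) (p t ^ j * (j * (p' / p t))) t := by
    intro p p' j hp hpt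
    refine (hp.fun_pow j).congr_deriv ?_
    cases j with
    | zero => simp
    | succ i =>
      simp only [Nat.add_sub_cancel, pow_succ]
      field_simp
  refine ((hpow hf hft (j := k)).fun_div (hpow hg hgt (j := l))
    (pow_ne_zero l hgt)).congr_deriv ?_
  field_simp

/-- the `r → ∞` conclusion of Theorem 3.2, rotationally symmetric case:
let `f, g : [0,∞) → ℝ` be smooth with `f(0) = g(0) = 0`, `f'(0) = g'(0) = 1`,
`f, g > 0` on `(0,∞)`.  If `(n-1)f'/f ≥ (m-1)g'/g` on `(0,∞)` then
`μ_n(f, ∞) ≥ μ_m(g, ∞)`. -/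
theorem stmt9 (n m : ℕ) (hn : 2 ≤ n) (hm : 2 ≤ m)
    (f g : ℝ → ℝ) (hf : ContDiffOn ℝ (⊤ : ℕ∞) f (Set.Ici 0)) (hg : ContDiffOn ℝ (⊤ : ℕ∞) g (Set.Ici 0))
    (hf0 : f 0 = 0) (hg0 : g 0 = 0)
    (hf'0 : derivWithin f (Set.Ici 0) 0 = 1) (hg'0 : derivWithin g (Set.Ici 0) 0 = 1)
    (hfpos : ∀ t : ℝ, 0 < t → 0 < f t) (hgpos : ∀ t : ℝ, 0 < t → 0 < g t)
    (hcomp : ∀ t : ℝ, 0 < t →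
      ((m : ℝ) - 1) * (derivWithin g (Set.Ici 0) t / g t) ≤
        ((n : ℝ) - 1) * (derivWithin f (Set.Ici 0) t / f t)) :
    mu m g (Set.Ioi 0) ≤ mu n f (Set.Ioi 0) := by
  have hder : ∀ {p : ℝ → ℝ}, ContDiffOn ℝ (⊤ : ℕ∞) p (Set.Ici 0) → ∀ t, 0 < t →
      HasDerivAt p (derivWithin p (Set.Ici 0) t) t := fun hp t ht =>
    ((hp.differentiableOn (by simp)) t ht.le).hasDerivWithinAt.hasDerivAt (Ici_mem_nhds ht)
  have hfc : ContinuousOn (fun t => f t ^ (n - 1)) (Set.Ioi 0) :=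
    (hf.continuousOn.mono Set.Ioi_subset_Ici_self).pow _
  have hgc : ContinuousOn (fun t => g t ^ (m - 1)) (Set.Ioi 0) :=
    (hg.continuousOn.mono Set.Ioi_subset_Ici_self).pow _
  refine le_csInf ?_ ?_
  · let B : ContDiffBump (2 : ℝ) := ⟨1 / 2, 1, by norm_num, by norm_num⟩
    refine ⟨_, B, B.contDiff, B.hasCompactSupport, ?_, fun h => ?_, rfl⟩
    · rw [B.tsupport_eq, Real.closedBall_eq_Icc]
      intro t ht
      have h1 : (2 : ℝ) - 1 ≤ t := ht.1
      exact Set.mem_Ioi.2 (by linarith)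
    · have h1 : B 2 = 1 :=
        B.one_of_mem_closedBall (Metric.mem_closedBall_self (by norm_num [B]))
      rw [h] at h1
      simp at h1
  rintro q ⟨φ, hφ, hφc, hφs, hφ0, rfl⟩
  obtain ⟨a, b, ha0, hab, ha, hb⟩ := exists_bounds_of_tsupport_subset_Ioi hφc hφs
  have hb0 : 0 < b := ha0.trans hab
  rw [mu_numerator_eq (W := fun t => f t ^ (n - 1)) hφ ha0 hab.le ha hb,
    mu_denominator_eq (W := fun t => f t ^ (n - 1)) ha0 hab.le ha hb,
    le_div_iff₀ (integral_sq_mul_pos hφ.continuous hfc (fun t ht => pow_pos (hfpos t ht) _)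
      hφ0 ha0 hab ha hb)]
  set c := mu m g (Set.Ioi 0)
  obtain ⟨C, hC, hgC⟩ := exists_pow_le_mul (hg.of_le (by exact_mod_cast le_top)) hg0 hgpos
    (k := m - 1) (by omega) hb0
  have hφ' : Continuous (deriv φ) := hφ.continuous_deriv (by exact_mod_cast le_top)
  have hInt : ∀ {v W : ℝ → ℝ}, Continuous v → ContinuousOn W (Set.Ioi 0) → ∀ {x : ℝ}, 0 < x →
      IntervalIntegrable (fun t => v t ^ 2 * W t) volume x b := by
    intro v W hv hW x hx
    exact ((hv.pow 2).continuousOn.mul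
      (hW.mono fun z hz => (lt_min hx hb0).trans_le hz.1)).intervalIntegrable
  have htail : ∀ s, 0 < s → s < b →
      0 ≤ ∫ t in s..b, (deriv φ t ^ 2 * g t ^ (m - 1) - c * (φ t ^ 2 * g t ^ (m - 1))) := by
    intro s hs hsb
    rw [intervalIntegral.integral_sub (hInt hφ' hgc hs)
      ((hInt hφ.continuous hgc hs).const_mul c), intervalIntegral.integral_const_mul, sub_nonneg]
    exact (weightedPoincare_mu hgpos).free_boundary (mu_Ioi_nonneg hgpos) hgc
      (fun t ht => pow_nonneg (hgpos t ht).le _) hC hgC hφ hb hs hsb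
  have hmain := integral_mul_nonneg_of_tails_nonneg (ρ := fun t => f t ^ (n - 1) / g t ^ (m - 1))
    (h := fun t => deriv φ t ^ 2 * g t ^ (m - 1) - c * (φ t ^ 2 * g t ^ (m - 1))) ha0 hab
    (((hφ'.pow 2).continuousOn.mul hgc).sub
      (continuousOn_const.mul ((hφ.continuous.pow 2).continuousOn.mul hgc)))
    (fun t ht => hasDerivAt_pow_div_pow (hder hf t ht) (hder hg t ht) (hfpos t ht).ne'
      (hgpos t ht).ne')
    (fun t ht => by
      have h1 := hcomp t ht
      have h2 := hfpos t ht
      have h3 := hgpos t ht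
      rw [Nat.cast_pred (by omega), Nat.cast_pred (by omega)]
      exact mul_nonneg (by positivity) (sub_nonneg.2 h1))
    (by
      have h2 := hfpos a ha0
      have h3 := hgpos a ha0
      positivity) htail
  rw [← sub_nonneg, ← intervalIntegral.integral_const_mul,
    ← intervalIntegral.integral_sub (hInt hφ' hfc ha0) ((hInt hφ.continuous hfc ha0).const_mul c)]
  refine hmain.trans_eq (intervalIntegral.integral_congr fun t ht => ?_)
  rw [Set.uIcc_of_le hab.le] at ht
  have hgt := (hgpos t (ha0.trans_le ht.1)).ne'
  field_simp
end

section
/- Let n ≥ 2 be an integer, κ ∈ ℝ, λ > 0, and 0 < r < ∞, with r < π/√κ when κ > 0. Let u : [0, r] → ℝ be continuous, C¹ on [0, r), and twice differentiable on (0, r), with u′(0) = 0, u(t) > 0 for all t ∈ [0, r), and u″(t) + (n−1)(S_κ′(t)/S_κ(t)) u′(t) + λ u(t) = 0 for all t ∈ (0, r). Then u′(t) < 0 for every t ∈ (0, r). -/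
open scoped ENNReal Topology
open MeasureTheory

theorem Sk_zero (κ : ℝ) : Sk κ 0 = 0 := by
  unfold Sk
  split_ifs <;> simp

theorem differentiable_Sk (κ : ℝ) : Differentiable ℝ (Sk κ) := by
  unfold Sk
  split_ifs <;> fun_prop

theorem Sk_pos {κ t : ℝ} (ht : 0 < t) (hκ : 0 < κ → t < Real.pi / Real.sqrt κ) :
    0 < Sk κ t := by
  unfold Sk
  split_ifs with h1 h2
  · have h : 0 < Real.sqrt (-κ) := Real.sqrt_pos.2 (by linarith)
    exact div_pos (Real.sinh_pos_iff.2 (by positivity)) h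
  · exact ht
  · have hpos : 0 < κ := lt_of_le_of_ne (not_lt.1 h1) (Ne.symm h2)
    have h : 0 < Real.sqrt κ := Real.sqrt_pos.2 hpos
    refine div_pos (Real.sin_pos_of_pos_of_lt_pi (by positivity) ?_) h
    rw [mul_comm]
    exact (lt_div_iff₀ h).1 (hκ hpos)

/-- monotonicity of the radial model eigenfunction: if `u : [0,r] → ℝ` is
continuous, `C¹` on `[0,r)`, twice differentiable on `(0,r)`, positive on `[0,r)`, with
`u'(0) = 0` and `u'' + (n-1)(S_κ'/S_κ)u' + λu = 0` on `(0,r)` (where `λ > 0` and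
`r < π/√κ` if `κ > 0`), then `u' < 0` on `(0,r)`. -/
theorem stmt10 (n : ℕ) (hn : 2 ≤ n) (κ lam r : ℝ) (hlam : 0 < lam) (hr : 0 < r)
    (hrκ : 0 < κ → r < Real.pi / Real.sqrt κ)
    (u : ℝ → ℝ) (hu_cont : ContinuousOn u (Set.Icc 0 r))
    (hu_c1 : ContDiffOn ℝ 1 u (Set.Ico 0 r))
    (hu_diff1 : ∀ t ∈ Set.Ioo 0 r, DifferentiableAt ℝ u t)
    (hu_diff2 : ∀ t ∈ Set.Ioo 0 r, DifferentiableAt ℝ (deriv u) t)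
    (hu'0 : derivWithin u (Set.Ico 0 r) 0 = 0)
    (hupos : ∀ t ∈ Set.Ico 0 r, 0 < u t)
    (hode : ∀ t ∈ Set.Ioo 0 r,
      deriv (deriv u) t + ((n : ℝ) - 1) * (deriv (Sk κ) t / Sk κ t) * deriv u t +
        lam * u t = 0) :
    ∀ t ∈ Set.Ioo 0 r, deriv u t < 0 := by
  obtain ⟨m, rfl⟩ := Nat.exists_eq_add_of_le' hn
  have hSpos : ∀ t ∈ Set.Ioo 0 r, 0 < Sk κ t := fun t ht =>
    Sk_pos ht.1 fun hκ => ht.2.trans (hrκ hκ)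
  have heq : ∀ t ∈ Set.Ioo 0 r, derivWithin u (Set.Ico 0 r) t = deriv u t := fun t ht =>
    derivWithin_of_mem_nhds (Ico_mem_nhds ht.1 ht.2)
  have hanti : StrictAntiOn
      (fun t => Sk κ t ^ (m + 1) * derivWithin u (Set.Ico 0 r) t) (Set.Ico 0 r) := by
    refine strictAntiOn_of_deriv_neg (convex_Ico 0 r) ?_ ?_
    · exact ((differentiable_Sk κ).continuous.pow _).continuousOn.mul
        (hu_c1.continuousOn_derivWithin (uniqueDiffOn_Ico 0 r) le_rfl)
    · intro t ht
      rw [interior_Ico] at ht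
      have hS := hSpos t ht
      have hloc : (fun t => Sk κ t ^ (m + 1) * derivWithin u (Set.Ico 0 r) t) =ᶠ[𝓝 t]
          fun t => Sk κ t ^ (m + 1) * deriv u t := by
        filter_upwards [Ioo_mem_nhds ht.1 ht.2] with x hx
        rw [heq x hx]
      have hderiv := (((differentiable_Sk κ) t).hasDerivAt.pow (m + 1)).mul
        (hu_diff2 t ht).hasDerivAt
      have hval : ((m + 1 : ℕ) : ℝ) * Sk κ t ^ (m + 1 - 1) * deriv (Sk κ) t * deriv u t +
          Sk κ t ^ (m + 1) * deriv (deriv u) t = -(lam * Sk κ t ^ (m + 1) * u t) := by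
        have hode' := hode t ht
        rw [show deriv (deriv u) t = -(((m + 2 : ℕ) : ℝ) - 1) *
          (deriv (Sk κ) t / Sk κ t) * deriv u t - lam * u t by linarith]
        push_cast
        field_simp
        ring
      have hu := hupos t ⟨ht.1.le, ht.2⟩
      rw [hloc.deriv_eq]
      refine (hderiv.deriv.trans hval).trans_lt ?_
      exact neg_neg_of_pos (by positivity)
  intro t ht
  have h := hanti ⟨le_rfl, hr⟩ ⟨ht.1.le, ht.2⟩ ht.1
  simp only [Sk_zero, heq t ht, zero_pow (Nat.succ_ne_zero m), zero_mul] at h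
  exact neg_of_mul_neg_right h (pow_pos (hSpos t ht) _).le
end

section
/- For every κ < 0 there exists a smooth function f : [0, ∞) → ℝ with f(0) = 0, f′(0) = 1, and f(t) > 0 for all t > 0, such that f′(t)/f(t) ≥ S_κ′(t)/S_κ(t) for all t > 0, while −f″(t)/f(t) > κ for all t > 1. -/
open scoped ENNReal Topology
open MeasureTheory

theorem Sk_of_neg {κ : ℝ} (hκ : κ < 0) :
    Sk κ = fun t => Real.sinh (Real.sqrt (-κ) * t) / Real.sqrt (-κ) := by
  funext t
  simp [Sk, hκ]

theorem hasDerivAt_sinh_mul_div {c : ℝ} (hc : c ≠ 0) (t : ℝ) :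
    HasDerivAt (fun t => Real.sinh (c * t) / c) (Real.cosh (c * t)) t := by
  have h := (((hasDerivAt_id t).const_mul c).sinh).div_const c
  exact h.congr_deriv (by simp [hc])

theorem hasDerivAt_cosh_mul (c t : ℝ) :
    HasDerivAt (fun t => Real.cosh (c * t)) (c * Real.sinh (c * t)) t := by
  have h := ((hasDerivAt_id t).const_mul c).cosh
  exact h.congr_deriv (by simp [mul_comm])

theorem hasDerivAt_exp_neg_mul (A t : ℝ) :
    HasDerivAt (fun t => Real.exp (-(A * t))) (-(A * Real.exp (-(A * t)))) t := by
  have h := ((hasDerivAt_id t).const_mul A).neg.exp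
  exact h.congr_deriv (by simp [mul_comm])

theorem cosh_lt_mul_sinh {a x : ℝ} (ha : 0 < a) (hax : a ≤ x) :
    Real.cosh x < (1 + 1 / Real.sinh a) * Real.sinh x := by
  have hsa : 0 < Real.sinh a := Real.sinh_pos_iff.2 ha
  have hle : Real.sinh a ≤ Real.sinh x := Real.sinh_le_sinh.2 hax
  have hexp : Real.exp (-x) < 1 := Real.exp_lt_one_iff.2 (by linarith)
  have hsub := Real.cosh_sub_sinh x
  have hone : 1 ≤ Real.sinh x / Real.sinh a := (one_le_div hsa).2 hle
  calc Real.cosh x < Real.sinh x + Real.sinh x / Real.sinh a := by linarith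
    _ = (1 + 1 / Real.sinh a) * Real.sinh x := by ring

/-- existence claim of Example 4.1: for every `κ < 0` there is a smooth
`f : [0,∞) → ℝ` with `f(0) = 0`, `f'(0) = 1`, `f > 0` on `(0,∞)`, satisfying the mean
curvature comparison `f'/f ≥ S_κ'/S_κ` on all of `(0,∞)`, while the radial sectional
curvature satisfies `-f''/f > κ` for all `t > 1`. -/
theorem stmt14 (κ : ℝ) (hκ : κ < 0) :
    ∃ f : ℝ → ℝ, ContDiffOn ℝ (⊤ : ℕ∞) f (Set.Ici 0) ∧ f 0 = 0 ∧
      derivWithin f (Set.Ici 0) 0 = 1 ∧ (∀ t : ℝ, 0 < t → 0 < f t) ∧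
      (∀ t : ℝ, 0 < t → deriv (Sk κ) t / Sk κ t ≤ deriv f t / f t) ∧
      (∀ t : ℝ, 1 < t → κ < -deriv (deriv f) t / f t) := by
  obtain ⟨c, hc, hcκ⟩ : ∃ c : ℝ, 0 < c ∧ c = Real.sqrt (-κ) :=
    ⟨_, Real.sqrt_pos.2 (neg_pos.2 hκ), rfl⟩
  have hsq : κ = -(c * c) := by
    rw [hcκ, Real.mul_self_sqrt (by linarith), neg_neg]
  have hSk : Sk κ = fun t => Real.sinh (c * t) / c := by rw [Sk_of_neg hκ, hcκ]
  have hsinh : ∀ t : ℝ, 0 < t → 0 < Real.sinh (c * t) := fun t ht =>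
    Real.sinh_pos_iff.2 (mul_pos hc ht)
  obtain ⟨A, hA, hcosh⟩ : ∃ A : ℝ, 0 < A ∧
      ∀ t : ℝ, 1 < t → 2 * c * Real.cosh (c * t) < A * Real.sinh (c * t) := by
    have hs : 0 < Real.sinh c := Real.sinh_pos_iff.2 hc
    refine ⟨2 * c * (1 + 1 / Real.sinh c), by positivity, fun t ht => ?_⟩
    rw [mul_assoc (2 * c)]
    exact mul_lt_mul_of_pos_left (cosh_lt_mul_sinh hc (by nlinarith)) (by positivity)
  have hf' : ∀ t : ℝ,
      HasDerivAt (fun t => Real.sinh (c * t) / c * (2 - Real.exp (-(A * t))))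
        (Real.cosh (c * t) * (2 - Real.exp (-(A * t)))
          + Real.sinh (c * t) / c * (A * Real.exp (-(A * t)))) t := fun t => by
    have h := (hasDerivAt_sinh_mul_div hc.ne' t).mul ((hasDerivAt_exp_neg_mul A t).const_sub 2)
    exact h.congr_deriv (by ring)
  have hf'' : ∀ t : ℝ,
      HasDerivAt (fun t => Real.cosh (c * t) * (2 - Real.exp (-(A * t)))
          + Real.sinh (c * t) / c * (A * Real.exp (-(A * t))))
        (c * Real.sinh (c * t) * (2 - Real.exp (-(A * t)))
          + A * Real.exp (-(A * t)) * (2 * Real.cosh (c * t) - A * (Real.sinh (c * t) / c)))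
        t := fun t => by
    have h := ((hasDerivAt_cosh_mul c t).mul ((hasDerivAt_exp_neg_mul A t).const_sub 2)).add
      ((hasDerivAt_sinh_mul_div hc.ne' t).mul ((hasDerivAt_exp_neg_mul A t).const_mul A))
    exact h.congr_deriv (by ring)
  have hg : ∀ t : ℝ, 0 < t → 0 < 2 - Real.exp (-(A * t)) := fun t ht => by
    have := Real.exp_lt_one_iff.2 (neg_lt_zero.2 (mul_pos hA ht))
    linarith
  have hpos : ∀ t : ℝ, 0 < t → 0 < Real.sinh (c * t) / c * (2 - Real.exp (-(A * t))) :=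
    fun t ht => mul_pos (div_pos (hsinh t ht) hc) (hg t ht)
  refine ⟨fun t => Real.sinh (c * t) / c * (2 - Real.exp (-(A * t))), ?_, by simp, ?_, hpos,
    fun t ht => ?_, fun t ht => ?_⟩
  · exact ContDiff.contDiffOn (by fun_prop)
  · rw [(hf' 0).hasDerivWithinAt.derivWithin (uniqueDiffOn_Ici 0 0 Set.self_mem_Ici)]
    norm_num
  · rw [hSk, (hasDerivAt_sinh_mul_div hc.ne' t).deriv, (hf' t).deriv,
      div_le_div_iff₀ (div_pos (hsinh t ht) hc) (hpos t ht)]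
    have hnonneg : 0 ≤ Real.sinh (c * t) / c * (A * Real.exp (-(A * t)))
        * (Real.sinh (c * t) / c) := by
      have := hsinh t ht
      positivity
    linarith
  · have ht0 : 0 < t := by linarith
    rw [funext fun t => (hf' t).deriv, (hf'' t).deriv, lt_div_iff₀ (hpos t ht0), hsq]
    have hneg : 2 * Real.cosh (c * t) - A * (Real.sinh (c * t) / c) < 0 := by
      rw [sub_neg, ← mul_div_assoc, lt_div_iff₀ hc]
      linarith [hcosh t ht]
    have hlt := mul_neg_of_pos_of_neg (mul_pos hA (Real.exp_pos (-(A * t)))) hneg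
    have heq : -(c * c) * (Real.sinh (c * t) / c * (2 - Real.exp (-(A * t))))
        = -(c * Real.sinh (c * t) * (2 - Real.exp (-(A * t)))) := by
      field_simp
    linarith
end
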